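/- arXiv:1712.00314 — 4 statements merged into one kernel-verified Lean document; each statement's English description precedes it below -/
import Mathlib

section
/- Let G be an object of the Gorenstein subcategory 𝒢(𝒞). Then there exists a short exact sequence 0→G'→P→G→0 in 𝒜 with P projective and G'∈𝒢(𝒞), which remains exact after applying Hom_𝒜(C,−) and after applying Hom_𝒜(−,C) for every C∈𝒞. -/
open CategoryTheory CategoryTheory.Limits CategoryTheory.Abelian ZeroObject

universe w t v u

variable {A : Type u} [Category.{v} A] [Abelian A]

/-- `f`, `g` form a short exact sequence `0 ⟶ X ⟶ Y ⟶ Z ⟶ 0` in `A`. -/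
def IsSES {X Y Z : A} (f : X ⟶ Y) (g : Y ⟶ Z) : Prop :=
  ∃ hw : f ≫ g = 0, (ShortComplex.mk f g hw).ShortExact

/-- The short exact sequence `0 ⟶ X ⟶ Y ⟶ Z ⟶ 0` remains exact after applying
`Hom_A(C, -)` for every `C` in `𝒞`. -/
def HomLeftExact (𝒞 : A → Prop) {X Y Z : A} (f : X ⟶ Y) (g : Y ⟶ Z) : Prop :=
  ∀ ⦃C : A⦄, 𝒞 C →
    Function.Injective (fun h : C ⟶ X => h ≫ f) ∧
    Function.Exact (fun h : C ⟶ X => h ≫ f) (fun h : C ⟶ Y => h ≫ g) ∧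
    Function.Surjective (fun h : C ⟶ Y => h ≫ g)

/-- The short exact sequence `0 ⟶ X ⟶ Y ⟶ Z ⟶ 0` remains exact after applying
`Hom_A(-, C)` for every `C` in `𝒞`. -/
def HomRightExact (𝒞 : A → Prop) {X Y Z : A} (f : X ⟶ Y) (g : Y ⟶ Z) : Prop :=
  ∀ ⦃C : A⦄, 𝒞 C →
    Function.Injective (fun h : Z ⟶ C => g ≫ h) ∧
    Function.Exact (fun h : Z ⟶ C => g ≫ h) (fun h : Y ⟶ C => f ≫ h) ∧
    Function.Surjective (fun h : Y ⟶ C => f ≫ h)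

/-- `M` belongs to the Gorenstein subcategory `𝒢(𝒞)`: there is an exact sequence
`⋯ ⟶ C_1 ⟶ C_0 ⟶ C^0 ⟶ C^1 ⟶ ⋯` with all terms in `𝒞`, which remains exact after
applying `Hom_A(C,-)` and `Hom_A(-,C)` for every `C ∈ 𝒞`, such that
`M ≅ Im(C_0 ⟶ C^0)`. -/
def IsGorenstein (𝒞 : A → Prop) (M : A) : Prop :=
  ∃ (X : ℤ → A) (d : ∀ n : ℤ, X n ⟶ X (n + 1)) (hw : ∀ n, d n ≫ d (n + 1) = 0),
    (∀ n, 𝒞 (X n)) ∧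
    (∀ n, (ShortComplex.mk (d n) (d (n + 1)) (hw n)).Exact) ∧
    (∀ (n : ℤ) ⦃C : A⦄, 𝒞 C →
      Function.Exact (fun h : C ⟶ X n => h ≫ d n) (fun h : C ⟶ X (n + 1) => h ≫ d (n + 1))) ∧
    (∀ (n : ℤ) ⦃C : A⦄, 𝒞 C →
      Function.Exact (fun h : X (n + 1 + 1) ⟶ C => d (n + 1) ≫ h)
        (fun h : X (n + 1) ⟶ C => d n ≫ h)) ∧
    Nonempty (M ≅ Limits.image (d 0))

/-- `𝒞` is a full additive subcategory closed under isomorphisms, encoded as a predicate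
closed under isomorphisms, containing a zero object and closed under binary biproducts. -/
def IsAdditiveClosed (𝒞 : A → Prop) : Prop :=
  (∀ ⦃X Y : A⦄, (X ≅ Y) → 𝒞 X → 𝒞 Y) ∧ 𝒞 (0 : A) ∧ ∀ ⦃X Y : A⦄, 𝒞 X → 𝒞 Y → 𝒞 (X ⊞ Y)

/-- `𝒫(A)` is a generator for `𝒞`: for every `C ∈ 𝒞` there is a short exact sequence
`0 ⟶ C' ⟶ P ⟶ C ⟶ 0` with `P` projective and `C' ∈ 𝒞`. -/
def ProjIsGeneratorFor (𝒞 : A → Prop) : Prop :=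
  ∀ ⦃C : A⦄, 𝒞 C → ∃ (C' P : A) (f : C' ⟶ P) (g : P ⟶ C),
    Projective P ∧ 𝒞 C' ∧ IsSES f g

section Ext

variable [HasExt.{w} A]

/-- `𝒞` is self-orthogonal: `Ext^i(C, C') = 0` for all `i ≥ 1` and `C, C' ∈ 𝒞`. -/
def SelfOrthogonal (𝒞 : A → Prop) : Prop :=
  ∀ ⦃C C' : A⦄, 𝒞 C → 𝒞 C' → ∀ i : ℕ, 1 ≤ i → Subsingleton (Abelian.Ext C C' i)

/-- `M ∈ 𝒢(𝒞)^{⊥1}`, i.e. `Ext^1(G, M) = 0` for every `G ∈ 𝒢(𝒞)`. -/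
def RightPerp1 (𝒞 : A → Prop) (M : A) : Prop :=
  ∀ ⦃G : A⦄, IsGorenstein 𝒞 G → Subsingleton (Abelian.Ext G M 1)

/-- `f : G ⟶ M` is a special `𝒢(𝒞)`-precover of `M`. -/
def IsSpecialPrecover (𝒞 : A → Prop) {G M : A} (f : G ⟶ M) : Prop :=
  IsGorenstein 𝒞 G ∧ Epi f ∧ RightPerp1 𝒞 (kernel f) ∧
    ∀ ⦃G' : A⦄, IsGorenstein 𝒞 G' → Function.Surjective (fun h : G' ⟶ G => h ≫ f)

/-- `M` belongs to the special precovered category `spc(𝒢(𝒞))`. -/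
def HasSpecialPrecover (𝒞 : A → Prop) (M : A) : Prop :=
  ∃ (G : A) (f : G ⟶ M), IsSpecialPrecover 𝒞 f

/-- `𝒞` is a generator for `𝒢(𝒞)^{⊥1}`. -/
def GeneratorForPerp (𝒞 : A → Prop) : Prop :=
  ∀ ⦃T : A⦄, RightPerp1 𝒞 T → ∃ (T' C : A) (f : T' ⟶ C) (g : C ⟶ T),
    𝒞 C ∧ RightPerp1 𝒞 T' ∧ IsSES f g

end Ext

/-- Under self-orthogonality, a generating short exact sequence `0 ⟶ C' ⟶ P ⟶ C ⟶ 0` splits. -/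
theorem projective_of_selfOrthogonal [HasExt.{w} A] {𝒞 : A → Prop}
    (hso : SelfOrthogonal 𝒞) (hgen : ProjIsGeneratorFor 𝒞) {C : A} (hC : 𝒞 C) :
    Projective C := by
  obtain ⟨C', P, f, g, hP, hC', hw, hS⟩ := hgen hC
  have := hso hC hC' 1 le_rfl
  obtain ⟨x, hx⟩ := Ext.covariant_sequence_exact₃ C hS (Ext.mk₀ (𝟙 C)) (zero_add 1)
    (Subsingleton.elim (α := Ext C C' 1) _ _)
  obtain ⟨s, rfl⟩ := (Ext.mk₀_bijective C P).2 x
  rw [Ext.mk₀_comp_mk₀] at hx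
  have hs : s ≫ g = 𝟙 C := (Ext.mk₀_bijective C C).1 hx
  exact Retract.projective ⟨s, g, hs⟩

/-- The differential of a sequence indexed by `ℤ`, with propositionally specified target. -/
def diffTo {B : Type u} [Category.{v} B] {X : ℤ → B} (d : ∀ n : ℤ, X n ⟶ X (n + 1))
    (i j : ℤ) (h : i + 1 = j) : X i ⟶ X j :=
  d i ≫ eqToHom (congrArg X h)

theorem diffTo_self {B : Type u} [Category.{v} B] {X : ℤ → B} (d : ∀ n : ℤ, X n ⟶ X (n + 1))
    (i : ℤ) : diffTo d i (i + 1) rfl = d i := by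
  simp [diffTo]

section

variable {𝒞 : A → Prop} {X Y Z : A} {f : X ⟶ Y} {g : Y ⟶ Z}

theorem homLeftExact_of_projective (h𝒞 : ∀ ⦃C : A⦄, 𝒞 C → Projective C) (h : IsSES f g) :
    HomLeftExact 𝒞 f g := by
  obtain ⟨hw, hS⟩ := h
  have : Mono f := hS.mono_f
  have : Epi g := hS.epi_g
  intro C hC
  have := h𝒞 hC
  refine ⟨fun a b hab => (cancel_mono f).1 hab, fun b => ⟨fun hb => ?_, ?_⟩, fun c =>
    ⟨Projective.factorThru c g, Projective.factorThru_comp c g⟩⟩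
  · exact ⟨hS.exact.lift b hb, hS.exact.lift_f b hb⟩
  · rintro ⟨a, rfl⟩
    simp [hw]

/-- If every map `W ⟶ C` killed by `a` extends along `p ≫ f`, for an epimorphism `p : W ⟶ X`
with `a ≫ p = 0`, then the short exact sequence `f`, `g` is `Hom(-, 𝒞)`-exact. -/
theorem homRightExact_of_epi (h : IsSES f g) {V W : A} (a : V ⟶ W) (p : W ⟶ X) [Epi p]
    (hap : a ≫ p = 0)
    (hext : ∀ ⦃C : A⦄, 𝒞 C → ∀ b : W ⟶ C, a ≫ b = 0 → ∃ c : Y ⟶ C, (p ≫ f) ≫ c = b) :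
    HomRightExact 𝒞 f g := by
  obtain ⟨hw, hS⟩ := h
  have : Epi g := hS.epi_g
  intro C hC
  refine ⟨fun a b hab => (cancel_epi g).1 hab, fun b => ⟨fun hb => ?_, ?_⟩, fun b => ?_⟩
  · exact ⟨hS.exact.desc b hb, hS.exact.g_desc b hb⟩
  · rintro ⟨c, rfl⟩
    simp [← Category.assoc, hw]
  · obtain ⟨c, hc⟩ := hext hC (p ≫ b) (by rw [← Category.assoc, hap, zero_comp])
    exact ⟨c, (cancel_epi p).1 (by simpa using hc)⟩

end

/-- every `G ∈ 𝒢(𝒞)` fits in a short exact sequence `0 ⟶ G' ⟶ P ⟶ G ⟶ 0`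
with `P` projective and `G' ∈ 𝒢(𝒞)`, which is `Hom(𝒞,-)`-exact and `Hom(-,𝒞)`-exact. -/
theorem stmt_0 [HasExt.{w} A] (𝒞 : A → Prop) (hadd : IsAdditiveClosed 𝒞)
    (hso : SelfOrthogonal 𝒞) (hgen : ProjIsGeneratorFor 𝒞)
    (G : A) (hG : IsGorenstein 𝒞 G) :
    ∃ (G' P : A) (f : G' ⟶ P) (g : P ⟶ G),
      Projective P ∧ IsGorenstein 𝒞 G' ∧ IsSES f g ∧
      HomLeftExact 𝒞 f g ∧ HomRightExact 𝒞 f g := by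
  have h𝒞 : ∀ ⦃C : A⦄, 𝒞 C → Projective C := fun C hC =>
    projective_of_selfOrthogonal hso hgen hC
  obtain ⟨X, d, hw, hX, hex, hl, hr, ⟨e⟩⟩ := hG
  have hw' (i j k : ℤ) (hij : i + 1 = j) (hjk : j + 1 = k) :
      diffTo d i j hij ≫ diffTo d j k hjk = 0 := by
    subst hij hjk
    simpa only [diffTo_self] using hw i
  have hex' (i j k : ℤ) (hij : i + 1 = j) (hjk : j + 1 = k) :
      (ShortComplex.mk _ _ (hw' i j k hij hjk)).Exact := by
    subst hij hjk
    simpa only [diffTo_self] using hex i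
  have hl' (i j k : ℤ) (hij : i + 1 = j) (hjk : j + 1 = k) ⦃C : A⦄ (hC : 𝒞 C) :
      Function.Exact (fun h : C ⟶ X i => h ≫ diffTo d i j hij)
        (fun h : C ⟶ X j => h ≫ diffTo d j k hjk) := by
    subst hij hjk
    simpa only [diffTo_self] using hl i hC
  have hr' (i j k : ℤ) (hij : i + 1 = j) (hjk : j + 1 = k) ⦃C : A⦄ (hC : 𝒞 C) :
      Function.Exact (fun h : X k ⟶ C => diffTo d j k hjk ≫ h)
        (fun h : X j ⟶ C => diffTo d i j hij ≫ h) := by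
    subst hij hjk
    simpa only [diffTo_self] using hr i hC
  have he (j : ℤ) (hj : j = 0) : Nonempty (G ≅ image (diffTo d j (j + 1) rfl)) := by
    subst hj
    rw [diffTo_self]
    exact ⟨e⟩
  obtain ⟨i, hi⟩ : ∃ i : ℤ, i = 0 - 1 := ⟨_, rfl⟩
  obtain ⟨j, hj⟩ : ∃ j : ℤ, j = 0 + 1 - 1 := ⟨_, rfl⟩
  have hij : i + 1 = j := by lia
  obtain ⟨e'⟩ := he j (by lia)
  let g : X j ⟶ G := factorThruImage (diffTo d j (j + 1) rfl) ≫ e'.inv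
  let m : G ⟶ X (j + 1) := e'.hom ≫ image.ι _
  have hgm : g ≫ m = diffTo d j (j + 1) rfl := by simp [g, m]
  have hdg : diffTo d i j hij ≫ g = 0 := by
    rw [← cancel_mono m, Category.assoc, hgm, hw', zero_comp]
  have hexg : (ShortComplex.mk _ _ hdg).Exact :=
    (ShortComplex.exact_iff_of_epi_of_isIso_of_mono
      ({ τ₁ := 𝟙 _, τ₂ := 𝟙 _, τ₃ := m, comm₂₃ := by simp [hgm] } :
        ShortComplex.mk _ _ hdg ⟶ ShortComplex.mk _ _ (hw' i j (j + 1) hij rfl))).2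
      (hex' i j (j + 1) hij rfl)
  let p : X i ⟶ kernel g := kernel.lift g _ hdg
  have : Epi p := (ShortComplex.exact_iff_epi_kernel_lift _).1 hexg
  have : StrongEpi p := strongEpi_of_epi p
  have hp : p ≫ kernel.ι g = diffTo d i j hij := kernel.lift_ι _ _ _
  have hses : IsSES (kernel.ι g) g :=
    ⟨kernel.condition g, { exact := ShortComplex.exact_kernel g }⟩
  refine ⟨kernel g, X j, kernel.ι g, g, h𝒞 (hX j), ?_, hses, homLeftExact_of_projective h𝒞 hses,
    homRightExact_of_epi hses (diffTo d (i - 1) i (by lia)) p ?_ ?_⟩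
  · have e₂ : kernel g ≅ image (diffTo d i j hij) := image.isoStrongEpiMono p (kernel.ι g) hp
    subst hi hj
    exact ⟨fun n => X (n - 1), fun n => diffTo d (n - 1) (n + 1 - 1) (by lia),
      fun n => hw' _ _ _ _ _, fun n => hX _, fun n => hex' _ _ _ _ _,
      fun n => hl' _ _ _ _ _, fun n => hr' _ _ _ _ _, ⟨e₂⟩⟩
  · rw [← cancel_mono (kernel.ι g), Category.assoc, hp, hw', zero_comp]
  · intro C hC b hb
    rw [hp]
    exact (hr' (i - 1) i j (by lia) hij hC b).1 hb
end

section
/- If M is an object of 𝒜 with Ext^1_𝒜(G,M)=0 for every G∈𝒢(𝒞), then Ext^i_𝒜(G,M)=0 for every i≥1 and every G∈𝒢(𝒞); that is, 𝒢(𝒞)^{⊥1}=𝒢(𝒞)^{⊥}. -/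
open CategoryTheory CategoryTheory.Limits CategoryTheory.Abelian ZeroObject

universe w t v u

variable {A : Type u} [Category.{v} A] [Abelian A]

/-- The objects of `𝒞` are Gorenstein, as witnessed by the constant complex on `C ⊞ C` with
differential `(x, y) ↦ (0, x)`. -/
theorem isGorenstein_of_mem {𝒞 : A → Prop} (hadd : IsAdditiveClosed 𝒞) {C : A} (hC : 𝒞 C) :
    IsGorenstein 𝒞 C := by
  have hd : (biprod.fst ≫ biprod.inr : C ⊞ C ⟶ C ⊞ C) ≫
      (biprod.fst ≫ biprod.inr : C ⊞ C ⟶ C ⊞ C) = 0 := by simp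
  refine ⟨fun _ => C ⊞ C, fun _ => biprod.fst ≫ biprod.inr, fun _ => hd,
    fun _ => hadd.2.2 hC hC, fun _ => ?_, fun _ Y _ h => ?_, fun _ Y _ h => ?_, ⟨?_⟩⟩
  · rw [ShortComplex.exact_iff_exact_up_to_refinements]
    intro T x hx
    have hx' : x ≫ biprod.fst = 0 := by simpa using hx =≫ biprod.snd
    refine ⟨T, 𝟙 T, inferInstance, x ≫ biprod.snd ≫ biprod.inl, ?_⟩
    ext <;> simp [hx']
  · refine ⟨fun hh => ⟨h ≫ biprod.snd ≫ biprod.inl, ?_⟩, ?_⟩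
    · have hx' : h ≫ biprod.fst = 0 := by simpa using hh =≫ biprod.snd
      ext <;> simp [hx']
    · rintro ⟨k, rfl⟩
      simp
  · refine ⟨fun hh => ⟨biprod.snd ≫ biprod.inl ≫ h, ?_⟩, ?_⟩
    · have hx' : biprod.inr ≫ h = 0 := by simpa using biprod.inl ≫= hh
      ext <;> simp [hx']
    · rintro ⟨k, rfl⟩
      simp
  · exact image.isoStrongEpiMono (biprod.fst : C ⊞ C ⟶ C) (biprod.inr : C ⟶ C ⊞ C) rfl

/-- An exact pair of morphisms induces a short exact sequence between their images. -/
theorem shortExact_image {X Y Z : A} {f : X ⟶ Y} {g : Y ⟶ Z} {w : f ≫ g = 0}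
    (h : (ShortComplex.mk f g w).Exact) :
    IsSES (Limits.image.ι f) (factorThruImage g) := by
  have w₁ : f ≫ factorThruImage g = 0 := by simp [← cancel_mono (Limits.image.ι g), w]
  have w₂ : Limits.image.ι f ≫ factorThruImage g = 0 := by
    simp [← cancel_epi (factorThruImage f), w₁]
  let φ : ShortComplex.mk f (factorThruImage g) w₁ ⟶ ShortComplex.mk f g w :=
    { τ₁ := 𝟙 _, τ₂ := 𝟙 _, τ₃ := Limits.image.ι g }
  let ψ : ShortComplex.mk f (factorThruImage g) w₁ ⟶
      ShortComplex.mk (Limits.image.ι f) (factorThruImage g) w₂ :=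
    { τ₁ := factorThruImage f, τ₂ := 𝟙 _, τ₃ := 𝟙 _ }
  have : Epi φ.τ₁ := inferInstanceAs (Epi (𝟙 X))
  have : IsIso φ.τ₂ := inferInstanceAs (IsIso (𝟙 Y))
  have : Mono φ.τ₃ := inferInstanceAs (Mono (Limits.image.ι g))
  have : Epi ψ.τ₁ := inferInstanceAs (Epi (factorThruImage f))
  have : IsIso ψ.τ₂ := inferInstanceAs (IsIso (𝟙 Y))
  have : Mono ψ.τ₃ := inferInstanceAs (Mono (𝟙 _))
  exact ⟨w₂, .mk ((ShortComplex.exact_iff_of_epi_of_isIso_of_mono ψ).1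
    ((ShortComplex.exact_iff_of_epi_of_isIso_of_mono φ).2 h))⟩

/-- Every Gorenstein object is the quotient of an object of `𝒞` by a Gorenstein object. -/
theorem IsGorenstein.exists_syzygy {𝒞 : A → Prop} {G : A} (hG : IsGorenstein 𝒞 G) :
    ∃ (G' C : A) (f : G' ⟶ C) (g : C ⟶ G), 𝒞 C ∧ IsGorenstein 𝒞 G' ∧ IsSES f g := by
  obtain ⟨X, d, hw, hX, hex, hl, hr, ⟨e⟩⟩ := hG
  let d' (i j : ℤ) (h : i + 1 = j) : X i ⟶ X j := d i ≫ eqToHom (congrArg X h)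
  have hw' (i j k : ℤ) (hij : i + 1 = j) (hjk : j + 1 = k) : d' i j hij ≫ d' j k hjk = 0 := by
    subst hij hjk
    simpa [d'] using hw i
  have hex' (i j k : ℤ) (hij : i + 1 = j) (hjk : j + 1 = k) :
      (ShortComplex.mk (d' i j hij) (d' j k hjk) (hw' i j k hij hjk)).Exact := by
    subst hij hjk
    simpa [d'] using hex i
  have hl' (i j k : ℤ) (hij : i + 1 = j) (hjk : j + 1 = k) ⦃C : A⦄ (hC : 𝒞 C) :
      Function.Exact (fun h : C ⟶ X i => h ≫ d' i j hij)
        (fun h : C ⟶ X j => h ≫ d' j k hjk) := by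
    subst hij hjk
    simpa [d'] using hl i hC
  have hr' (i j k : ℤ) (hij : i + 1 = j) (hjk : j + 1 = k) ⦃C : A⦄ (hC : 𝒞 C) :
      Function.Exact (fun h : X k ⟶ C => d' j k hjk ≫ h)
        (fun h : X j ⟶ C => d' i j hij ≫ h) := by
    subst hij hjk
    simpa [d'] using hr i hC
  have e' : G ≅ image (d' 0 (0 + 1) rfl) := e ≪≫ eqToIso (by simp [d'])
  obtain ⟨w, hS⟩ := shortExact_image (hex' (0 - 1) 0 (0 + 1) (by simp) rfl)
  have hn (n : ℤ) : n - 1 + 1 = n + 1 - 1 := by ring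
  refine ⟨image (d' (0 - 1) 0 (by simp)), X 0, Limits.image.ι _, factorThruImage _ ≫ e'.inv, hX 0,
    ⟨fun n => X (n - 1), fun n => d' (n - 1) (n + 1 - 1) (hn n),
      fun n => hw' _ _ _ (hn n) (hn (n + 1)),
      fun n => hX _, fun n => hex' _ _ _ (hn n) (hn (n + 1)),
      fun n => hl' _ _ _ (hn n) (hn (n + 1)), fun n => hr' _ _ _ (hn n) (hn (n + 1)),
      ⟨Iso.refl _⟩⟩, by rw [← Category.assoc, w, zero_comp], ?_⟩
  exact ShortComplex.shortExact_of_iso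
    (ShortComplex.isoMk (S₁ := .mk _ _ w) (Iso.refl _) (Iso.refl _) e'.symm (by simp) (by simp)) hS

/-- Dimension shifting along a short exact sequence `0 ⟶ X ⟶ Y ⟶ Z ⟶ 0`. -/
theorem subsingleton_ext_succ_of_isSES [HasExt.{w} A] {X Y Z M : A} {f : X ⟶ Y} {g : Y ⟶ Z}
    (h : IsSES f g) (n : ℕ) [Subsingleton (Abelian.Ext X M n)]
    [Subsingleton (Abelian.Ext Y M (n + 1))] : Subsingleton (Abelian.Ext Z M (n + 1)) := by
  obtain ⟨w, hS⟩ := h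
  refine subsingleton_of_forall_eq 0 fun x => ?_
  obtain ⟨y, rfl⟩ := Ext.contravariant_sequence_exact₃ hS M x (Subsingleton.elim _ _)
    (add_comm 1 n)
  rw [Subsingleton.elim y 0, Ext.comp_zero]

/-- `𝒢(𝒞)^{⊥1} = 𝒢(𝒞)^{⊥}`. -/
theorem stmt_1 [HasExt.{w} A] (𝒞 : A → Prop) (hadd : IsAdditiveClosed 𝒞)
    (hso : SelfOrthogonal 𝒞) (hgen : ProjIsGeneratorFor 𝒞)
    (M : A) (hM : ∀ ⦃G : A⦄, IsGorenstein 𝒞 G → Subsingleton (Abelian.Ext G M 1)) :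
    ∀ ⦃G : A⦄, IsGorenstein 𝒞 G → ∀ i : ℕ, 1 ≤ i → Subsingleton (Abelian.Ext G M i) := by
  have hC (i : ℕ) : ∀ ⦃C : A⦄, 𝒞 C → Subsingleton (Abelian.Ext C M (i + 1)) := by
    induction i with
    | zero => exact fun C hC => hM (isGorenstein_of_mem hadd hC)
    | succ i ih =>
      intro C hC
      obtain ⟨C', P, f, g, hP, hC', hS⟩ := hgen hC
      have := ih hC'
      have : Subsingleton (Abelian.Ext P M (i + 1 + 1)) :=
        subsingleton_of_forall_eq 0 Ext.eq_zero_of_projective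
      exact subsingleton_ext_succ_of_isSES hS (i + 1)
  have hG (i : ℕ) : ∀ ⦃G : A⦄, IsGorenstein 𝒞 G → Subsingleton (Abelian.Ext G M (i + 1)) := by
    induction i with
    | zero => exact hM
    | succ i ih =>
      intro G hG
      obtain ⟨G', C, f, g, hC₀, hG', hS⟩ := hG.exists_syzygy
      have := ih hG'
      have := hC (i + 1) hC₀
      exact subsingleton_ext_succ_of_isSES hS (i + 1)
  intro G hG' i hi
  obtain ⟨i, rfl⟩ := Nat.exists_eq_add_of_le' hi
  exact hG i hG'
end

section
/- Let R be an n-Gorenstein ring. Then a left R-module M satisfies Ext^1_R(G,M)=0 for every Gorenstein projective left R-module G if and only if M has projective dimension at most n, if and only if M has finite projective dimension, if and only if M has injective dimension at most n, if and only if M has finite injective dimension. -/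
open CategoryTheory CategoryTheory.Limits CategoryTheory.Abelian

universe w v u

variable {A : Type u} [Category.{v} A] [Abelian A]

/-- `𝒳`-dimension of `M` is at most `n`: there is an exact sequence
`0 ⟶ X_n ⟶ ⋯ ⟶ X_1 ⟶ X_0 ⟶ M ⟶ 0` with all `X_i ∈ 𝒳`. -/
def DimLE (𝒳 : A → Prop) : ℕ → A → Prop
  | 0, M => ∃ X : A, 𝒳 X ∧ Nonempty (M ≅ X)
  | n + 1, M => ∃ (K X : A) (f : K ⟶ X) (g : X ⟶ M), 𝒳 X ∧ IsSES f g ∧ DimLE 𝒳 n K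

/-- `𝒳`-codimension of `M` is at most `n`: there is an exact sequence
`0 ⟶ M ⟶ X^0 ⟶ X^1 ⟶ ⋯ ⟶ X^n ⟶ 0` with all `X^i ∈ 𝒳`. -/
def CodimLE (𝒳 : A → Prop) : ℕ → A → Prop
  | 0, M => ∃ X : A, 𝒳 X ∧ Nonempty (M ≅ X)
  | n + 1, M => ∃ (X K : A) (f : M ⟶ X) (g : X ⟶ K), 𝒳 X ∧ IsSES f g ∧ CodimLE 𝒳 n K

/-- `M` is Gorenstein projective: there is an exact sequence
`⋯ ⟶ P_1 ⟶ P_0 ⟶ P^0 ⟶ P^1 ⟶ ⋯` of projective objects which remains exact after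
applying `Hom(-, Q)` for every projective `Q`, with `M ≅ Im(P_0 ⟶ P^0)`. -/
def IsGorensteinProjective (M : A) : Prop :=
  ∃ (X : ℤ → A) (d : ∀ n : ℤ, X n ⟶ X (n + 1)) (hw : ∀ n, d n ≫ d (n + 1) = 0),
    (∀ n, Projective (X n)) ∧
    (∀ n, (ShortComplex.mk (d n) (d (n + 1)) (hw n)).Exact) ∧
    (∀ (n : ℤ) ⦃Q : A⦄, Projective Q →
      Function.Exact (fun h : X (n + 1 + 1) ⟶ Q => d (n + 1) ≫ h)
        (fun h : X (n + 1) ⟶ Q => d n ≫ h)) ∧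
    Nonempty (M ≅ Limits.image (d 0))

/-- Every homomorphism from a finitely generated module to `F` factors through a finitely
generated free module; over a left Noetherian ring this says that `F` is flat. -/
def FactorsThroughFiniteFree (R : Type u) [Ring R] (F : Type u) [AddCommGroup F] [Module R F] :
    Prop :=
  ∀ (X : Type u) [AddCommGroup X] [Module R X] [Module.Finite R X] (f : X →ₗ[R] F),
    ∃ (l : ℕ) (g : X →ₗ[R] (Fin l → R)) (h : (Fin l → R) →ₗ[R] F), h ∘ₗ g = f

namespace FactorsThroughFiniteFree

variable {R : Type u} [Ring R]

theorem of_retract {F P : Type u} [AddCommGroup F] [Module R F] [AddCommGroup P] [Module R P]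
    (hF : FactorsThroughFiniteFree R F) (s : P →ₗ[R] F) (p : F →ₗ[R] P)
    (hps : p ∘ₗ s = LinearMap.id) : FactorsThroughFiniteFree R P := by
  intro X _ _ _ f
  obtain ⟨l, g, h, hgh⟩ := hF X (s ∘ₗ f)
  refine ⟨l, g, p ∘ₗ h, ?_⟩
  rw [LinearMap.comp_assoc, hgh, ← LinearMap.comp_assoc, hps, LinearMap.id_comp]

theorem finsupp (S : Type u) : FactorsThroughFiniteFree R (S →₀ R) := by
  classical
  intro X _ _ _ f
  obtain ⟨k, x, hx⟩ := Module.Finite.exists_fin (R := R) (M := X)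
  let T : Finset S := Finset.univ.biUnion fun i => (f (x i)).support
  let e : Fin T.card ≃ T := T.equivFin.symm
  let g : (S →₀ R) →ₗ[R] (Fin T.card → R) := LinearMap.pi fun j => Finsupp.lapply (e j : S)
  let h : (Fin T.card → R) →ₗ[R] (S →₀ R) :=
    Fintype.linearCombination R fun j => Finsupp.single (e j : S) (1 : R)
  refine ⟨T.card, g ∘ₗ f, h, LinearMap.ext_on_range hx fun i => ?_⟩
  have hsum : h (g (f (x i))) = ∑ t : T, Finsupp.single (t : S) (f (x i) t) := by
    rw [← e.sum_comp]
    simp [h, g, Fintype.linearCombination_apply]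
  have hT : (f (x i)).support ⊆ T := Finset.subset_biUnion_of_mem (fun i => (f (x i)).support)
    (Finset.mem_univ i)
  simp only [LinearMap.comp_apply]
  rw [hsum, Finset.sum_coe_sort T fun t => Finsupp.single t (f (x i) t),
    ← Finsupp.sum_of_support_subset (f (x i)) hT (fun t a => Finsupp.single t a) (by simp)]
  exact Finsupp.sum_single _

theorem of_projective (P : Type u) [AddCommGroup P] [Module R P] [Module.Projective R P] :
    FactorsThroughFiniteFree R P := by
  obtain ⟨s, hs⟩ := Module.projective_def'.mp (inferInstance : Module.Projective R P)
  exact (finsupp P).of_retract s _ hs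

theorem of_exact {K P F : Type u} [AddCommGroup K] [Module R K] [AddCommGroup P] [Module R P]
    [Module.Projective R P] [AddCommGroup F] [Module R F] (hF : FactorsThroughFiniteFree R F)
    (i : K →ₗ[R] P) (p : P →ₗ[R] F) (hi : Function.Injective i) (hip : Function.Exact i p)
    (hp : Function.Surjective p) : FactorsThroughFiniteFree R K := by
  intro X _ _ _ f
  obtain ⟨k, g, h, hgh⟩ := of_projective P X (i ∘ₗ f)
  have hg : g.range ≤ LinearMap.ker (p ∘ₗ h) := by
    rintro _ ⟨x, rfl⟩
    have hx : h (g x) = i (f x) := LinearMap.congr_fun hgh x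
    simp [hx, hip.apply_apply_eq_zero]
  obtain ⟨l, a, b, hab⟩ := hF _ (g.range.liftQ (p ∘ₗ h) hg)
  obtain ⟨c, hc⟩ := Module.projective_lifting_property p b hp
  let d : (Fin k → R) →ₗ[R] P := h - c ∘ₗ a ∘ₗ g.range.mkQ
  have hd : ∀ y, p (d y) = 0 := by
    intro y
    have h1 : b (a (g.range.mkQ y)) = p (h y) := LinearMap.congr_fun hab (g.range.mkQ y)
    have h2 : p (c (a (g.range.mkQ y))) = b (a (g.range.mkQ y)) := LinearMap.congr_fun hc _
    simp only [d, LinearMap.sub_apply, LinearMap.comp_apply, map_sub, h2, h1, sub_self]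
  have hd' : ∀ y, d y ∈ i.range := fun y => (hip (d y)).mp (hd y)
  let e := LinearEquiv.ofInjective i hi
  refine ⟨k, g, e.symm.toLinearMap ∘ₗ d.codRestrict i.range hd', LinearMap.ext fun x => hi ?_⟩
  have he : ∀ z, i (e.symm z) = z := fun z => congrArg Subtype.val (e.apply_symm_apply z)
  have hx : h (g x) = i (f x) := LinearMap.congr_fun hgh x
  have h0 : g.range.mkQ (g x) = 0 := by simp
  simp only [LinearMap.comp_apply, LinearEquiv.coe_coe, he, LinearMap.codRestrict_apply, d,
    LinearMap.sub_apply, h0, map_zero, sub_zero, hx]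

end FactorsThroughFiniteFree

/-- The character group of a right `R`-module, as a left `R`-module. -/
def CharacterDual (R : Type u) [Ring R] (E : Type u) [AddCommGroup E] [Module Rᵐᵒᵖ E] : Type u :=
  E →+ AddCircle (1 : ℚ)

namespace CharacterDual

variable {R : Type u} [Ring R] {E E' E'' : Type u} [AddCommGroup E] [Module Rᵐᵒᵖ E]
  [AddCommGroup E'] [Module Rᵐᵒᵖ E'] [AddCommGroup E''] [Module Rᵐᵒᵖ E'']

noncomputable instance : AddCommGroup (CharacterDual R E) :=
  inferInstanceAs (AddCommGroup (E →+ AddCircle (1 : ℚ)))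

/-- The additive map underlying an element of the character dual. -/
noncomputable def toHom : CharacterDual R E ≃+ (E →+ AddCircle (1 : ℚ)) := AddEquiv.refl _

noncomputable instance : Module R (CharacterDual R E) where
  smul r c := toHom.symm ((toHom c).comp (DistribSMul.toAddMonoidHom E (MulOpposite.op r)))
  one_smul c := toHom.injective <| AddMonoidHom.ext fun e =>
    congrArg (toHom c) (one_smul Rᵐᵒᵖ e)
  mul_smul r s c := toHom.injective <| AddMonoidHom.ext fun e =>
    congrArg (toHom c) (mul_smul (MulOpposite.op s) (MulOpposite.op r) e)
  smul_zero _ := rfl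
  smul_add _ _ _ := rfl
  add_smul r s c := toHom.injective <| AddMonoidHom.ext fun e =>
    (congrArg (toHom c) (add_smul (MulOpposite.op r) (MulOpposite.op s) e)).trans (map_add _ _ _)
  zero_smul c := toHom.injective <| AddMonoidHom.ext fun e =>
    (congrArg (toHom c) (zero_smul Rᵐᵒᵖ e)).trans (map_zero _)

theorem toHom_smul (r : R) (c : CharacterDual R E) (e : E) :
    toHom (r • c) e = toHom c (MulOpposite.op r • e) := rfl

/-- The map of character duals induced by a homomorphism of right modules. -/
noncomputable def map (f : E →ₗ[Rᵐᵒᵖ] E') : CharacterDual R E' →ₗ[R] CharacterDual R E where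
  toFun c := toHom.symm ((toHom c).comp f.toAddMonoidHom)
  map_add' _ _ := rfl
  map_smul' r c := toHom.injective <| AddMonoidHom.ext fun e =>
    congrArg (toHom c) (f.map_smul (MulOpposite.op r) e).symm

theorem toHom_map (f : E →ₗ[Rᵐᵒᵖ] E') (c : CharacterDual R E') (e : E) :
    toHom (map f c) e = toHom c (f e) := rfl

theorem exists_extension {A B : Type u} [AddCommGroup A] [AddCommGroup B] (α : A →+ B)
    (φ : A →+ AddCircle (1 : ℚ)) (h : ∀ a, α a = 0 → φ a = 0) :
    ∃ ψ : B →+ AddCircle (1 : ℚ), ∀ a, ψ (α a) = φ a := by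
  let φ' : α.range →+ AddCircle (1 : ℚ) :=
    α.rangeRestrict.liftOfSurjective α.rangeRestrict_surjective ⟨φ, fun a ha =>
      h a (congrArg Subtype.val ha)⟩
  obtain ⟨ψ, hψ⟩ := CharacterModule.dual_surjective_of_injective
    (α.range.subtype.toIntLinearMap) Subtype.val_injective φ'
  refine ⟨ψ, fun a => ?_⟩
  have h1 : ψ (α a) = φ' (α.rangeRestrict a) := DFunLike.congr_fun hψ (α.rangeRestrict a)
  refine h1.trans ?_
  exact AddMonoidHom.liftOfRightInverse_comp_apply _ _ _ ⟨φ, _⟩ a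

theorem map_injective {f : E →ₗ[Rᵐᵒᵖ] E'} (hf : Function.Surjective f) :
    Function.Injective (map f) := by
  intro c d hcd
  refine toHom.injective (AddMonoidHom.ext fun e => ?_)
  obtain ⟨e, rfl⟩ := hf e
  exact DFunLike.congr_fun (congrArg toHom hcd) e

theorem map_surjective {f : E →ₗ[Rᵐᵒᵖ] E'} (hf : Function.Injective f) :
    Function.Surjective (map f) := by
  intro c
  obtain ⟨ψ, hψ⟩ := exists_extension f.toAddMonoidHom (toHom c) fun a ha => by
    rw [(map_eq_zero_iff f hf).mp ha, map_zero]
  exact ⟨toHom.symm ψ, toHom.injective (AddMonoidHom.ext hψ)⟩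

theorem map_exact {f : E →ₗ[Rᵐᵒᵖ] E'} {g : E' →ₗ[Rᵐᵒᵖ] E''} (h : Function.Exact f g) :
    Function.Exact (map g) (map f) := by
  intro c
  constructor
  · intro hc
    obtain ⟨ψ, hψ⟩ := exists_extension g.toAddMonoidHom (toHom c) fun a ha => by
      obtain ⟨b, rfl⟩ := (h a).mp ha
      exact DFunLike.congr_fun (congrArg toHom hc) b
    exact ⟨toHom.symm ψ, toHom.injective (AddMonoidHom.ext hψ)⟩
  · rintro ⟨d, rfl⟩
    refine toHom.injective (AddMonoidHom.ext fun e => ?_)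
    rw [toHom_map, toHom_map, h.apply_apply_eq_zero, map_zero, map_zero]
    rfl

theorem exists_injective_to_dual_free (I : Type u) [AddCommGroup I] [Module R I] :
    ∃ (S : Type u) (f : I →ₗ[R] CharacterDual R (S →₀ Rᵐᵒᵖ)), Function.Injective f := by
  let ev (x : I) : (CharacterModule I →₀ Rᵐᵒᵖ) →+ AddCircle (1 : ℚ) :=
    Finsupp.liftAddHom fun χ =>
      (AddMonoidHomClass.toAddMonoidHom χ).comp
        ((LinearMap.toSpanSingleton R I x).toAddMonoidHom.comp
          (MulOpposite.opAddEquiv (α := R)).symm.toAddMonoidHom)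
  have hev (x : I) (χ : CharacterModule I) (a : Rᵐᵒᵖ) :
      ev x (Finsupp.single χ a) = χ (a.unop • x) := by
    simp [ev]
  refine ⟨CharacterModule I,
    { toFun := fun x => toHom.symm (ev x)
      map_add' := fun x y => toHom.injective <| Finsupp.addHom_ext fun χ a => ?_
      map_smul' := fun r x => toHom.injective <| Finsupp.addHom_ext fun χ a => ?_ }, ?_⟩
  · rw [map_add, AddMonoidHom.add_apply]
    simp only [AddEquiv.apply_symm_apply, hev, smul_add, map_add]
  · rw [RingHom.id_apply, toHom_smul]
    simp only [AddEquiv.apply_symm_apply, hev, Finsupp.smul_single, smul_smul, smul_eq_mul,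
      MulOpposite.unop_mul, MulOpposite.unop_op]
  · refine (injective_iff_map_eq_zero _).mpr fun x hx => ?_
    refine CharacterModule.eq_zero_of_character_apply fun χ => ?_
    have h1 : ev x (Finsupp.single χ 1) = 0 :=
      DFunLike.congr_fun (congrArg toHom hx) (Finsupp.single χ 1)
    simpa [hev] using h1

end CharacterDual

theorem CharacterDual.factorsThroughFiniteFree {R : Type u} [Ring R] [IsNoetherianRing R]
    [IsNoetherianRing Rᵐᵒᵖ] (E : Type u) [AddCommGroup E] [Module Rᵐᵒᵖ E]
    [Module.Injective Rᵐᵒᵖ E] : FactorsThroughFiniteFree R (CharacterDual R E) := by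
  classical
  intro X _ _ _ f
  obtain ⟨k, π, hπ⟩ := Module.Finite.exists_fin' R X
  obtain ⟨m, ρ, hρ⟩ := Submodule.fg_iff_exists_fin_generating_family.mp
    (IsNoetherian.noetherian (LinearMap.ker π))
  let τ : (Fin k → Rᵐᵒᵖ) →ₗ[Rᵐᵒᵖ] (Fin m → Rᵐᵒᵖ) :=
    Fintype.linearCombination Rᵐᵒᵖ fun i s => MulOpposite.op (ρ s i)
  obtain ⟨l, z, hz⟩ := Submodule.fg_iff_exists_fin_generating_family.mp
    (IsNoetherian.noetherian (LinearMap.ker τ))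
  have hτ (a : Fin k → Rᵐᵒᵖ) (s : Fin m) : τ a s = ∑ i, a i * MulOpposite.op (ρ s i) := by
    simp [τ, Fintype.linearCombination_apply]
  have hρz (s : Fin m) (j : Fin l) : ∑ i, ρ s i * (z j i).unop = 0 := by
    have h1 : z j ∈ LinearMap.ker τ := hz ▸ Submodule.subset_span ⟨j, rfl⟩
    have h2 := hτ (z j) s
    rw [LinearMap.mem_ker.mp h1] at h2
    have h3 := congrArg MulOpposite.unop h2
    simpa using h3.symm
  let φ (i : Fin k) : CharacterDual R E := f (π (Pi.single i 1))
  have hρφ (s : Fin m) : ∑ i, ρ s i • φ i = 0 := by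
    have h1 : ρ s ∈ LinearMap.ker π := hρ ▸ Submodule.subset_span ⟨s, rfl⟩
    have h2 : f (π (ρ s)) = 0 := by rw [LinearMap.mem_ker.mp h1, map_zero]
    conv at h2 => rw [pi_eq_sum_univ' (ρ s)]
    simpa [φ, map_sum, map_smul] using h2
  let Φ : (Fin k → E) →+ AddCircle (1 : ℚ) :=
    ∑ i, (toHom (φ i)).comp (Pi.evalAddMonoidHom (fun _ : Fin k => E) i)
  have hΦ (e : Fin k → E) : Φ e = ∑ i, toHom (φ i) (e i) := by
    simp [Φ]
  let α : (Fin k → E) →+ (Fin l → E) :=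
    AddMonoidHom.pi fun j =>
      ∑ i, (DistribSMul.toAddMonoidHom E (z j i)).comp (Pi.evalAddMonoidHom (fun _ : Fin k => E) i)
  have hα (e : Fin k → E) (j : Fin l) : α e j = ∑ i, z j i • e i := by
    simp [α, AddMonoidHom.pi]
  obtain ⟨Ψ, hΨ⟩ := exists_extension α Φ fun e he => by
    let ε : (Fin k → Rᵐᵒᵖ) →ₗ[Rᵐᵒᵖ] E := Fintype.linearCombination Rᵐᵒᵖ e
    have hker : LinearMap.ker τ ≤ LinearMap.ker ε := by
      rw [← hz, Submodule.span_le]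
      rintro _ ⟨j, rfl⟩
      have := congrFun he j
      rw [hα] at this
      simpa [ε, Fintype.linearCombination_apply] using this
    obtain ⟨η, hη⟩ := Module.Injective.out ((LinearMap.ker τ).liftQ τ le_rfl)
      (LinearMap.ker_eq_bot.mp (Submodule.ker_liftQ_eq_bot' _ _ rfl))
      ((LinearMap.ker τ).liftQ ε hker)
    have hητ (a : Fin k → Rᵐᵒᵖ) : η (τ a) = ε a := hη ((LinearMap.ker τ).mkQ a)
    have hei (i : Fin k) : e i = ∑ s, MulOpposite.op (ρ s i) • η (Pi.single s 1) := by
      have h1 : ε (Pi.single i 1) = e i := by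
        simp [ε]
      have h2 : τ (Pi.single i 1) = ∑ s, MulOpposite.op (ρ s i) • Pi.single s 1 := by
        rw [← pi_eq_sum_univ' (fun s => MulOpposite.op (ρ s i))]
        simp [τ]
      rw [← h1, ← hητ, h2, map_sum]
      simp only [map_smul]
    rw [hΦ]
    calc ∑ i, toHom (φ i) (e i)
        = ∑ s, ∑ i, toHom (ρ s i • φ i) (η (Pi.single s 1)) := by
          rw [Finset.sum_comm]
          refine Finset.sum_congr rfl fun i _ => ?_
          rw [hei i, map_sum]
          rfl
      _ = 0 := by
          refine Finset.sum_eq_zero fun s _ => ?_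
          rw [← AddMonoidHom.finsetSum_apply, ← map_sum, hρφ, map_zero, AddMonoidHom.zero_apply]
  let γ : (Fin k → R) →ₗ[R] (Fin l → R) :=
    Fintype.linearCombination R fun i j => (z j i).unop
  have hγ : LinearMap.ker π ≤ LinearMap.ker γ := by
    rw [← hρ, Submodule.span_le]
    rintro _ ⟨s, rfl⟩
    refine LinearMap.mem_ker.mpr (funext fun j => ?_)
    simpa [γ, Fintype.linearCombination_apply] using hρz s j
  let h : (Fin l → R) →ₗ[R] CharacterDual R E :=
    Fintype.linearCombination R fun j =>
      toHom.symm (Ψ.comp (AddMonoidHom.single (fun _ : Fin l => E) j))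
  have hhγ : h ∘ₗ γ = f ∘ₗ π := by
    refine LinearMap.pi_ext' fun i => LinearMap.ext_ring (toHom.injective ?_)
    refine AddMonoidHom.ext fun e => ?_
    have h1 : γ (Pi.single i 1) = fun j => (z j i).unop := by simp [γ]
    have h2 : Ψ (α (Pi.single i e)) = toHom (φ i) e := by
      rw [hΨ, hΦ, Finset.sum_eq_single i] <;> simp +contextual
    have h3 : α (Pi.single i e) = fun j => z j i • e := by
      funext j
      rw [hα, Finset.sum_eq_single i] <;> simp +contextual
    change toHom (h (γ (Pi.single i 1))) e = toHom (φ i) e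
    rw [h1, ← h2, h3, ← Finset.univ_sum_single (fun j => z j i • e), map_sum]
    simp only [h, Fintype.linearCombination_apply, map_sum, AddMonoidHom.finsetSum_apply]
    rfl
  let e := π.quotKerEquivOfSurjective hπ
  refine ⟨l, (LinearMap.ker π).liftQ γ hγ ∘ₗ e.symm.toLinearMap, h, ?_⟩
  refine LinearMap.ext fun x => ?_
  obtain ⟨y, rfl⟩ := hπ x
  have hy : e.symm (π y) = (LinearMap.ker π).mkQ y := by
    rw [LinearEquiv.symm_apply_eq]
    rfl
  simp only [LinearMap.comp_apply, LinearEquiv.coe_coe, hy]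
  exact LinearMap.congr_fun hhγ y

section Abelian

theorem IsSES.mono {X Y Z : A} {f : X ⟶ Y} {g : Y ⟶ Z} (h : IsSES f g) : Mono f :=
  h.choose_spec.mono_f

theorem IsSES.epi {X Y Z : A} {f : X ⟶ Y} {g : Y ⟶ Z} (h : IsSES f g) : Epi g :=
  h.choose_spec.epi_g

theorem exists_isSES_of_enoughProjectives [EnoughProjectives A] (M : A) :
    ∃ (K P : A) (f : K ⟶ P) (g : P ⟶ M), Projective P ∧ IsSES f g :=
  ⟨_, _, kernel.ι (Projective.π M), Projective.π M, inferInstance, kernel.condition _,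
    { exact := ShortComplex.exact_kernel _ }⟩

theorem exists_isSES_of_enoughInjectives [EnoughInjectives A] (M : A) :
    ∃ (I K : A) (f : M ⟶ I) (g : I ⟶ K), Injective I ∧ IsSES f g :=
  ⟨_, _, Injective.ι M, cokernel.π (Injective.ι M), inferInstance, cokernel.condition _,
    { exact := ShortComplex.exact_cokernel _ }⟩

theorem dimLE_projective_iff [EnoughProjectives A] (n : ℕ) (M : A) :
    DimLE (fun P : A => Projective P) n M ↔ HasProjectiveDimensionLT M (n + 1) := by
  induction n generalizing M with
  | zero =>
    rw [zero_add, ← projective_iff_hasProjectiveDimensionLT_one]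
    exact ⟨fun ⟨_, hX, ⟨e⟩⟩ => Projective.of_iso e.symm hX, fun h => ⟨M, h, ⟨Iso.refl M⟩⟩⟩
  | succ n ih =>
    constructor
    · rintro ⟨K, P, f, g, hP, ⟨hw, hS⟩, hK⟩
      exact (hS.hasProjectiveDimensionLT_X₃_iff n hP).mpr ((ih K).mp hK)
    · intro h
      obtain ⟨K, P, f, g, hP, hw, hS⟩ := exists_isSES_of_enoughProjectives M
      exact ⟨K, P, f, g, hP, ⟨hw, hS⟩,
        (ih K).mpr ((hS.hasProjectiveDimensionLT_X₃_iff n hP).mp h)⟩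

theorem codimLE_injective_iff [EnoughInjectives A] (n : ℕ) (M : A) :
    CodimLE (fun I : A => Injective I) n M ↔ HasInjectiveDimensionLT M (n + 1) := by
  induction n generalizing M with
  | zero =>
    rw [zero_add, ← injective_iff_hasInjectiveDimensionLT_one]
    exact ⟨fun ⟨_, hX, ⟨e⟩⟩ => Injective.of_iso e.symm hX, fun h => ⟨M, h, ⟨Iso.refl M⟩⟩⟩
  | succ n ih =>
    constructor
    · rintro ⟨I, K, f, g, hI, ⟨hw, hS⟩, hK⟩
      exact (hS.hasInjectiveDimensionLT_X₃_iff n hI).mp ((ih K).mp hK)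
    · intro h
      obtain ⟨I, K, f, g, hI, hw, hS⟩ := exists_isSES_of_enoughInjectives M
      exact ⟨I, K, f, g, hI, ⟨hw, hS⟩,
        (ih K).mpr ((hS.hasInjectiveDimensionLT_X₃_iff n hI).mpr h)⟩

/-- Dimension shifting along an epimorphism from a projective object. -/
theorem IsSES.subsingleton_ext_left [HasExt.{w} A] {K P M : A} {f : K ⟶ P} {g : P ⟶ M}
    (hP : Projective P) (h : IsSES f g) (N : A) (n : ℕ) [Subsingleton (Ext M N (n + 2))] :
    Subsingleton (Ext K N (n + 1)) := by
  obtain ⟨hw, hS⟩ := h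
  refine subsingleton_of_forall_eq 0 fun x => ?_
  have hx : hS.extClass.comp x (add_comm 1 (n + 1)) = 0 := Subsingleton.elim _ _
  obtain ⟨y, rfl⟩ := Ext.contravariant_sequence_exact₁ hS N x _ hx
  have : Projective (ShortComplex.mk f g hw).X₂ := hP
  rw [Ext.eq_zero_of_projective y, Ext.comp_zero]

theorem IsSES.subsingleton_ext_right [HasExt.{w} A] {K P M : A} {f : K ⟶ P} {g : P ⟶ M}
    (hP : Projective P) (h : IsSES f g) (N : A) (n : ℕ) [Subsingleton (Ext K N (n + 1))] :
    Subsingleton (Ext M N (n + 2)) := by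
  obtain ⟨hw, hS⟩ := h
  refine subsingleton_of_forall_eq 0 fun x => ?_
  have : Projective (ShortComplex.mk f g hw).X₂ := hP
  obtain ⟨y, rfl⟩ := Ext.contravariant_sequence_exact₃ hS N x
    (Ext.eq_zero_of_projective _) (add_comm 1 (n + 1))
  rw [Subsingleton.elim y 0, Ext.comp_zero]

theorem IsSES.exists_extension [HasExt.{w} A] {X Y Z Q : A} {f : X ⟶ Y} {g : Y ⟶ Z}
    (h : IsSES f g) [Subsingleton (Ext Z Q 1)] (a : X ⟶ Q) : ∃ b : Y ⟶ Q, f ≫ b = a := by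
  obtain ⟨hw, hS⟩ := h
  obtain ⟨x, hx⟩ := Ext.contravariant_sequence_exact₁ hS Q (Ext.mk₀ a) (add_zero 1)
    (Subsingleton.elim (α := Ext Z Q 1) _ _)
  obtain ⟨b, rfl⟩ := Ext.homEquiv₀.symm.surjective x
  refine ⟨b, Ext.homEquiv₀.symm.injective ?_⟩
  simpa using hx

theorem IsSES.projective_of_subsingleton_ext_one [HasExt.{w} A] {X Y Z : A} {f : X ⟶ Y}
    {g : Y ⟶ Z} (h : IsSES f g) (hY : Projective Y) [Subsingleton (Ext Z X 1)] :
    Projective Z := by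
  obtain ⟨r, hr⟩ := h.exists_extension (𝟙 X)
  have := h.epi
  obtain ⟨hw, hS⟩ := h
  let s := ShortComplex.Splitting.ofExactOfRetraction _ hS.exact r hr this
  exact Retract.projective ⟨s.s, g, s.s_g⟩

/-- If a class of objects is closed under syzygies and its members have injective dimension at
most `n`, then its members have projective dimension at most `n`. -/
theorem hasProjectiveDimensionLT_of_syzygy_closed [EnoughProjectives A] (𝒞 : A → Prop)
    (hsyz : ∀ ⦃K P M : A⦄ (f : K ⟶ P) (g : P ⟶ M), Projective P → IsSES f g → 𝒞 M → 𝒞 K)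
    {n : ℕ} (hinj : ∀ M, 𝒞 M → HasInjectiveDimensionLT M (n + 1)) {M : A} (hM : 𝒞 M) :
    HasProjectiveDimensionLT M (n + 1) := by
  let := HasExt.standard A
  suffices ∀ (n : ℕ) (M : A), 𝒞 M → (∀ N, 𝒞 N → Subsingleton (Ext M N (n + 1))) →
      HasProjectiveDimensionLT M (n + 1) from
    this n M hM fun N hN => (hinj N hN).subsingleton _ _ _ le_rfl _
  intro n
  induction n with
  | zero =>
    intro M hM hext
    obtain ⟨K, P, f, g, hP, hS⟩ := exists_isSES_of_enoughProjectives M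
    have := hext K (hsyz f g hP hS hM)
    rw [zero_add, ← projective_iff_hasProjectiveDimensionLT_one]
    exact hS.projective_of_subsingleton_ext_one hP
  | succ n ih =>
    intro M hM hext
    obtain ⟨K, P, f, g, hP, hS⟩ := exists_isSES_of_enoughProjectives M
    refine (hS.choose_spec.hasProjectiveDimensionLT_X₃_iff n hP).mpr
      (ih K (hsyz f g hP hS hM) fun N hN => ?_)
    have := hext N hN
    exact hS.subsingleton_ext_left hP N n

theorem hasInjectiveDimensionLT_of_hasProjectiveDimensionLT [EnoughProjectives A] {n : ℕ}
    (hproj : ∀ P : A, Projective P → HasInjectiveDimensionLT P (n + 1)) (m : ℕ) {M : A}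
    (hM : HasProjectiveDimensionLT M (m + 1)) : HasInjectiveDimensionLT M (n + 1) := by
  induction m generalizing M with
  | zero => exact hproj M (projective_iff_hasProjectiveDimensionLT_one.mpr hM)
  | succ m ih =>
    obtain ⟨K, P, f, g, hP, hw, hS⟩ := exists_isSES_of_enoughProjectives M
    have := ih ((hS.hasProjectiveDimensionLT_X₃_iff m hP).mp hM)
    exact hS.hasInjectiveDimensionLT_X₃ (n + 1) (hproj P hP)
      (hasInjectiveDimensionLT_of_ge K (n + 1) (n + 2) (by lia))

theorem hasProjectiveDimensionLT_of_finite [EnoughProjectives A] {n : ℕ}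
    (hproj : ∀ P : A, Projective P → HasInjectiveDimensionLT P (n + 1)) (m : ℕ) {M : A}
    (hM : HasProjectiveDimensionLT M (m + 1)) : HasProjectiveDimensionLT M (n + 1) := by
  refine hasProjectiveDimensionLT_of_syzygy_closed
    (fun N => HasProjectiveDimensionLT N (m + 1)) (fun K P M f g hP hS h => ?_)
    (fun N hN => hasInjectiveDimensionLT_of_hasProjectiveDimensionLT hproj m hN) hM
  exact hS.choose_spec.hasProjectiveDimensionLT_X₁ (m + 1)
    (hasProjectiveDimensionLT_of_ge P 1 (m + 1) (by lia))
    (hasProjectiveDimensionLT_of_ge M (m + 1) (m + 2) (by lia))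

theorem hasProjectiveDimensionLT_of_hasInjectiveDimensionLT [EnoughInjectives A] {n : ℕ}
    (hinj : ∀ I : A, Injective I → HasProjectiveDimensionLT I (n + 1)) (m : ℕ) {M : A}
    (hM : HasInjectiveDimensionLT M (m + 1)) : HasProjectiveDimensionLT M (n + 1) := by
  induction m generalizing M with
  | zero => exact hinj M (injective_iff_hasInjectiveDimensionLT_one.mpr hM)
  | succ m ih =>
    obtain ⟨I, K, f, g, hI, hw, hS⟩ := exists_isSES_of_enoughInjectives M
    have := ih ((hS.hasInjectiveDimensionLT_X₃_iff m hI).mpr hM)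
    exact hS.hasProjectiveDimensionLT_X₁ (n + 1) (hinj I hI)
      (hasProjectiveDimensionLT_of_ge K (n + 1) (n + 2) (by lia))

/-- `X` is the kernel of an epimorphism from a projective object onto `Y`. -/
def IsSyzygyStep (X Y : A) : Prop :=
  ∃ (P : A) (f : X ⟶ P) (g : P ⟶ Y), Projective P ∧ IsSES f g

theorem exact_iff_of_epi_of_mono {W X Y Z T : A} {e : W ⟶ X} {f : X ⟶ Y} {g : Y ⟶ Z}
    {m : Z ⟶ T} {a : W ⟶ Y} {b : Y ⟶ T} [Epi e] [Mono m] (ha : e ≫ f = a) (hb : g ≫ m = b)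
    (hfg : f ≫ g = 0) (hab : a ≫ b = 0) :
    (ShortComplex.mk f g hfg).Exact ↔ (ShortComplex.mk a b hab).Exact := by
  have hfb : f ≫ b = 0 := by rw [← hb, reassoc_of% hfg, zero_comp]
  let φ : ShortComplex.mk a b hab ⟶ ShortComplex.mk f b hfb :=
    { τ₁ := e, τ₂ := 𝟙 Y, τ₃ := 𝟙 T, comm₁₂ := by simp [ha], comm₂₃ := by simp }
  let ψ : ShortComplex.mk f g hfg ⟶ ShortComplex.mk f b hfb :=
    { τ₁ := 𝟙 X, τ₂ := 𝟙 Y, τ₃ := m, comm₁₂ := by simp, comm₂₃ := by simp [hb] }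
  have : Epi φ.τ₁ := inferInstanceAs (Epi e)
  have : IsIso φ.τ₂ := inferInstanceAs (IsIso (𝟙 Y))
  have : Mono φ.τ₃ := inferInstanceAs (Mono (𝟙 T))
  have : Epi ψ.τ₁ := inferInstanceAs (Epi (𝟙 X))
  have : IsIso ψ.τ₂ := inferInstanceAs (IsIso (𝟙 Y))
  have : Mono ψ.τ₃ := inferInstanceAs (Mono m)
  exact (ShortComplex.exact_iff_of_epi_of_isIso_of_mono ψ).trans
    (ShortComplex.exact_iff_of_epi_of_isIso_of_mono φ).symm

theorem subsingleton_ext_one_of_syzygy_chain [HasExt.{w} A] {Z : ℤ → A}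
    (hZ : ∀ k, IsSyzygyStep (Z k) (Z (k + 1))) {N : A} {n : ℕ}
    (hN : HasInjectiveDimensionLT N (n + 1)) (k : ℤ) : Subsingleton (Ext (Z k) N 1) := by
  suffices ∀ (j i : ℕ) (k : ℤ), i + j = n → Subsingleton (Ext (Z k) N (i + 1)) from
    this n 0 k (zero_add n)
  intro j
  induction j with
  | zero =>
    rintro i k rfl
    exact hN.subsingleton _ _ _ le_rfl _
  | succ j ih =>
    intro i k hij
    obtain ⟨P, f, g, hP, hS⟩ := hZ k
    have := ih (i + 1) (k + 1) (by lia)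
    exact hS.subsingleton_ext_left hP N i

theorem IsGorensteinProjective.subsingleton_ext_one [HasExt.{w} A] {G : A}
    (hG : IsGorensteinProjective G) {N : A} {n : ℕ} (hN : HasInjectiveDimensionLT N (n + 1)) :
    Subsingleton (Ext G N 1) := by
  obtain ⟨X, d, hw, hproj, hex, -, ⟨e⟩⟩ := hG
  have hZ (k : ℤ) : IsSyzygyStep (Limits.image (d k)) (Limits.image (d (k + 1))) := by
    have hw' : Limits.image.ι (d k) ≫ factorThruImage (d (k + 1)) = 0 := by
      rw [← cancel_epi (factorThruImage (d k)), ← cancel_mono (Limits.image.ι (d (k + 1)))]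
      simpa using hw k
    exact ⟨X (k + 1), Limits.image.ι (d k), factorThruImage (d (k + 1)), hproj _, hw',
      { exact := (exact_iff_of_epi_of_mono (Limits.image.fac _) (Limits.image.fac _)
          hw' (hw k)).mpr (hex k)
        mono_f := inferInstanceAs (Mono (Limits.image.ι (d k)))
        epi_g := inferInstanceAs (Epi (factorThruImage (d (k + 1)))) }⟩
  have := subsingleton_ext_one_of_syzygy_chain hZ hN 0
  refine subsingleton_of_forall_eq 0 fun x => ?_
  rw [← Ext.mk₀_id_comp x, ← e.hom_inv_id, ← Ext.mk₀_comp_mk₀_assoc,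
    Subsingleton.elim ((Ext.mk₀ e.inv).comp x (zero_add 1)) 0, Ext.comp_zero]

theorem exists_int_chain {α : Type*} (r : α → α → Prop) (S : α → Prop)
    (hright : ∀ x, S x → ∃ y, S y ∧ r x y) (hleft : ∀ x, ∃ y, r y x) {a : α} (ha : S a) :
    ∃ Z : ℤ → α, Z 0 = a ∧ ∀ k, r (Z k) (Z (k + 1)) := by
  choose! next hnext hr using hright
  choose prev hl using hleft
  have hS (k : ℕ) : S (next^[k] a) := by
    induction k with
    | zero => exact ha
    | succ k ih => rw [Function.iterate_succ_apply']; exact hnext _ ih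
  refine ⟨fun k => Int.casesOn k (fun i => next^[i] a) (fun i => prev^[i + 1] a), rfl, ?_⟩
  rintro (k | _ | k)
  · have := hr _ (hS k)
    rwa [← Function.iterate_succ_apply' next] at this
  · exact hl a
  · have := hl (prev^[k + 1] a)
    rw [← Function.iterate_succ_apply' prev] at this
    have hk : Int.negSucc (k + 1) + 1 = Int.negSucc k := by lia
    rw [hk]
    exact this

theorem isGorensteinProjective_of_syzygy_chain [HasExt.{w} A] {Z : ℤ → A}
    (hZ : ∀ k, IsSyzygyStep (Z k) (Z (k + 1)))
    (hext : ∀ (k : ℤ) (Q : A), Projective Q → Subsingleton (Ext (Z k) Q 1)) :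
    IsGorensteinProjective (Z (0 + 1)) := by
  choose P f g hP hS using hZ
  have hepi (k : ℤ) : Epi (g k) := (hS k).epi
  have hmono (k : ℤ) : Mono (f k) := (hS k).mono
  have hfg (k : ℤ) : f k ≫ g k = 0 := (hS k).choose
  refine ⟨P, fun k => g k ≫ f (k + 1), fun k => by simp [reassoc_of% hfg], hP, fun k => ?_,
    fun k Q hQ h => ⟨fun hh => ?_, ?_⟩, ⟨?_⟩⟩
  · exact (exact_iff_of_epi_of_mono rfl rfl (hfg (k + 1)) _).mp
      (hS (k + 1)).choose_spec.exact
  · have h1 : f (k + 1) ≫ h = 0 := by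
      rw [← cancel_epi (g k)]
      simpa using hh
    let h2 := (hS (k + 1)).choose_spec.exact.desc h h1
    have h3 : g (k + 1) ≫ h2 = h := (hS (k + 1)).choose_spec.exact.g_desc h h1
    have := hext (k + 1 + 1 + 1) Q hQ
    obtain ⟨b, hb⟩ := (hS (k + 1 + 1)).exists_extension h2
    exact ⟨b, by simp [hb, h3]⟩
  · rintro ⟨b, rfl⟩
    simp [reassoc_of% hfg]
  · have := strongEpi_of_epi (g 0)
    exact Limits.image.isoStrongEpiMono (g 0) (f (0 + 1)) rfl

end Abelian

section ModuleCat

variable {R : Type u} [Ring R]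

theorem isSES_ofHom {X Y Z : Type u} [AddCommGroup X] [Module R X] [AddCommGroup Y] [Module R Y]
    [AddCommGroup Z] [Module R Z] {f : X →ₗ[R] Y} {g : Y →ₗ[R] Z} (hf : Function.Injective f)
    (hfg : Function.Exact f g) (hg : Function.Surjective g) :
    IsSES (ModuleCat.ofHom f) (ModuleCat.ofHom g) :=
  ⟨ModuleCat.hom_ext (LinearMap.ext hfg.apply_apply_eq_zero),
    ModuleCat.shortComplex_shortExact _ hfg hf hg⟩

theorem isSES_iff {X Y Z : ModuleCat.{u} R} {f : X ⟶ Y} {g : Y ⟶ Z} :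
    IsSES f g ↔ Function.Injective f.hom ∧ Function.Exact f.hom g.hom ∧
      Function.Surjective g.hom := by
  constructor
  · rintro ⟨hw, hS⟩
    exact ⟨hS.moduleCat_injective_f,
      (ShortComplex.ShortExact.moduleCat_exact_iff_function_exact _).mp hS.exact,
      hS.moduleCat_surjective_g⟩
  · rintro ⟨hf, hfg, hg⟩
    exact isSES_ofHom hf hfg hg

theorem Ext.exists_eq_comp_of_factorsThroughFiniteFree [IsNoetherianRing R] {F : ModuleCat.{u} R}
    (hF : FactorsThroughFiniteFree R F) (n : ℕ) (X : ModuleCat.{u} R) [Module.Finite R X]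
    (e : Ext X F n) : ∃ (l : ℕ) (e' : Ext X (ModuleCat.of R (Fin l → R)) n)
      (h : ModuleCat.of R (Fin l → R) ⟶ F), e'.comp (Ext.mk₀ h) (add_zero n) = e := by
  induction n generalizing X with
  | zero =>
    obtain ⟨l, g, h, hgh⟩ := hF X (Ext.homEquiv₀ e).hom
    refine ⟨l, Ext.mk₀ (ModuleCat.ofHom g), ModuleCat.ofHom h, ?_⟩
    rw [Ext.mk₀_comp_mk₀, ← Ext.mk₀_homEquiv₀_apply e, ← ModuleCat.ofHom_comp, hgh]
    rfl
  | succ n ih =>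
    obtain ⟨k, π, hπ⟩ := Module.Finite.exists_fin' R X
    have hS : IsSES (ModuleCat.ofHom (LinearMap.ker π).subtype) (ModuleCat.ofHom π) :=
      isSES_ofHom Subtype.val_injective (LinearMap.exact_subtype_ker_map π) hπ
    obtain ⟨hw, hS⟩ := hS
    obtain ⟨e₁, he₁⟩ := Ext.contravariant_sequence_exact₃ hS F e
      (Ext.eq_zero_of_projective (P := ModuleCat.of R (Fin k → R)) _) (add_comm 1 n)
    have : Module.Finite R (ModuleCat.of R (LinearMap.ker π)) :=
      inferInstanceAs (Module.Finite R (LinearMap.ker π))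
    obtain ⟨l, e', h, rfl⟩ := ih _ e₁
    exact ⟨l, hS.extClass.comp e' (add_comm 1 n), h,
      (Ext.comp_assoc_of_third_deg_zero _ _ _ _).trans he₁⟩

theorem hasInjectiveDimensionLT_of_finite (n : ℕ) (F : ModuleCat.{u} R)
    (h : ∀ (X : ModuleCat.{u} R) [Module.Finite R X], Subsingleton (Ext X F (n + 1))) :
    HasInjectiveDimensionLT F (n + 1) := by
  induction n generalizing F with
  | zero =>
    rw [zero_add, ← injective_iff_hasInjectiveDimensionLT_one]
    have : Module.Injective R F := Module.Baer.injective fun I g => by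
      have := h (ModuleCat.of R (R ⧸ I))
      obtain ⟨b, hb⟩ := (isSES_ofHom (R := R) (f := I.subtype) (g := I.mkQ) Subtype.val_injective
        (LinearMap.exact_subtype_mkQ I) I.mkQ_surjective).exists_extension
          (Q := F) (ModuleCat.ofHom g)
      exact ⟨b.hom, fun x hx => LinearMap.congr_fun (congrArg ModuleCat.Hom.hom hb) ⟨x, hx⟩⟩
    exact Module.injective_object_of_injective_module R F
  | succ n ih =>
    obtain ⟨I, C, f, g, hI, hw, hS⟩ := exists_isSES_of_enoughInjectives F
    refine (hS.hasInjectiveDimensionLT_X₃_iff n hI).mp (ih C fun X _ => ?_)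
    have := h X
    refine subsingleton_of_forall_eq 0 fun x => ?_
    obtain ⟨y, rfl⟩ := Ext.covariant_sequence_exact₃ X hS x rfl
      (Subsingleton.elim (α := Ext X F (n + 1 + 1)) _ _)
    have : Injective (ShortComplex.mk f g hw).X₂ := hI
    rw [Ext.eq_zero_of_injective y, Ext.zero_comp]

theorem hasInjectiveDimensionLT_fin {n : ℕ}
    (h : HasInjectiveDimensionLT (ModuleCat.of R R) (n + 1)) (l : ℕ) :
    HasInjectiveDimensionLT (ModuleCat.of R (Fin l → R)) (n + 1) := by
  induction l with
  | zero =>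
    have := (ModuleCat.isZero_of_subsingleton
      (ModuleCat.of R (Fin 0 → R))).hasInjectiveDimensionLT_zero
    exact hasInjectiveDimensionLT_of_ge _ 0 _ (by lia)
  | succ l ih =>
    have hS : IsSES (ModuleCat.ofHom (LinearMap.single R (fun _ : Fin (l + 1) => R) 0))
        (ModuleCat.ofHom (LinearMap.funLeft R R (Fin.succ (n := l)))) := by
      refine isSES_ofHom (Pi.single_injective (M := fun _ => R) 0) (fun x => ⟨fun hx => ⟨x 0, ?_⟩, ?_⟩)
        (LinearMap.funLeft_surjective_of_injective R R _ (Fin.succ_injective l))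
      · funext i
        refine Fin.cases ?_ (fun j => ?_) i
        · simp
        · simpa using (congrFun hx j).symm
      · rintro ⟨y, rfl⟩
        funext j
        simp [LinearMap.funLeft_apply]
    exact hS.choose_spec.hasInjectiveDimensionLT_X₂ _ h ih

theorem FactorsThroughFiniteFree.hasInjectiveDimensionLT [IsNoetherianRing R] {n : ℕ}
    (h : HasInjectiveDimensionLT (ModuleCat.of R R) (n + 1)) {F : ModuleCat.{u} R}
    (hF : FactorsThroughFiniteFree R F) : HasInjectiveDimensionLT F (n + 1) := by
  refine hasInjectiveDimensionLT_of_finite n F fun X _ => subsingleton_of_forall_eq 0 fun e => ?_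
  obtain ⟨l, e', f, rfl⟩ := Ext.exists_eq_comp_of_factorsThroughFiniteFree hF _ X e
  have := hasInjectiveDimensionLT_fin h l
  rw [e'.eq_zero_of_hasInjectiveDimensionLT (n + 1) le_rfl, Ext.zero_comp]

theorem hasInjectiveDimensionLT_of_projective [IsNoetherianRing R] {n : ℕ}
    (h : HasInjectiveDimensionLT (ModuleCat.of R R) (n + 1)) (P : ModuleCat.{u} R)
    (hP : Projective P) : HasInjectiveDimensionLT P (n + 1) :=
  (FactorsThroughFiniteFree.of_projective P).hasInjectiveDimensionLT h

theorem FactorsThroughFiniteFree.hasProjectiveDimensionLT [IsNoetherianRing R] {n : ℕ}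
    (h : HasInjectiveDimensionLT (ModuleCat.of R R) (n + 1)) {F : ModuleCat.{u} R}
    (hF : FactorsThroughFiniteFree R F) : HasProjectiveDimensionLT F (n + 1) := by
  refine hasProjectiveDimensionLT_of_syzygy_closed
    (fun M : ModuleCat.{u} R => FactorsThroughFiniteFree R M) (fun K P M f g hP hS hM => ?_)
    (fun M hM => hM.hasInjectiveDimensionLT h) hF
  obtain ⟨hf, hfg, hg⟩ := isSES_iff.mp hS
  exact hM.of_exact f.hom g.hom hf hfg hg

end ModuleCat

section CharacterDual

variable {R : Type u} [Ring R]

theorem CharacterDual.hasProjectiveDimensionLT [IsNoetherianRing R] [IsNoetherianRing Rᵐᵒᵖ]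
    {n : ℕ} (h : HasInjectiveDimensionLT (ModuleCat.of R R) (n + 1)) (m : ℕ)
    {N : ModuleCat.{u} Rᵐᵒᵖ} (hN : HasInjectiveDimensionLT N (m + 1)) :
    HasProjectiveDimensionLT (ModuleCat.of R (CharacterDual R N)) (n + m + 1) := by
  have hinj (I : ModuleCat.{u} Rᵐᵒᵖ) (hI : Injective I) :
      HasProjectiveDimensionLT (ModuleCat.of R (CharacterDual R I)) (n + 1) := by
    have := Module.injective_module_of_injective_object Rᵐᵒᵖ I
    exact FactorsThroughFiniteFree.hasProjectiveDimensionLT h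
      (CharacterDual.factorsThroughFiniteFree I)
  induction m generalizing N with
  | zero => exact hinj N (injective_iff_hasInjectiveDimensionLT_one.mpr hN)
  | succ m ih =>
    obtain ⟨I, K, f, g, hI, hS⟩ := exists_isSES_of_enoughInjectives N
    have hK := ih ((hS.choose_spec.hasInjectiveDimensionLT_X₃_iff m hI).mpr hN)
    obtain ⟨hf, hfg, hg⟩ := isSES_iff.mp hS
    have := hinj I hI
    obtain ⟨hw, hD⟩ := isSES_ofHom (map_injective hg) (map_exact hfg) (map_surjective hf)
    exact hD.hasProjectiveDimensionLT_X₃ (n + m + 1) hK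
      (hasProjectiveDimensionLT_of_ge _ (n + 1) _ (by lia))

theorem hasProjectiveDimensionLT_of_injective [IsNoetherianRing R] [IsNoetherianRing Rᵐᵒᵖ]
    {n m : ℕ} (h : HasInjectiveDimensionLT (ModuleCat.of R R) (n + 1))
    (h' : HasInjectiveDimensionLT (ModuleCat.of Rᵐᵒᵖ Rᵐᵒᵖ) (m + 1)) (I : ModuleCat.{u} R)
    (hI : Injective I) : HasProjectiveDimensionLT I (n + 1) := by
  obtain ⟨S, f, hf⟩ := CharacterDual.exists_injective_to_dual_free (R := R) I
  have hfree : HasInjectiveDimensionLT (ModuleCat.of Rᵐᵒᵖ (S →₀ Rᵐᵒᵖ)) (m + 1) :=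
    (FactorsThroughFiniteFree.finsupp S).hasInjectiveDimensionLT h'
  have hD := CharacterDual.hasProjectiveDimensionLT h m hfree
  have : Mono (ModuleCat.ofHom f) := (ModuleCat.mono_iff_injective _).mpr hf
  have r : Retract I (ModuleCat.of R (CharacterDual R (S →₀ Rᵐᵒᵖ))) :=
    ⟨ModuleCat.ofHom f, Injective.factorThru (𝟙 I) (ModuleCat.ofHom f),
      Injective.comp_factorThru _ _⟩
  have : HasProjectiveDimensionLT (ModuleCat.of R (CharacterDual R (S →₀ Rᵐᵒᵖ))) (n + m + 1) := hD
  exact hasProjectiveDimensionLT_of_finite (hasInjectiveDimensionLT_of_projective h) (n + m)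
    (r.hasProjectiveDimensionLT _)

end CharacterDual

/-- `K` is an `n`-th syzygy of `M`. -/
def IsSyzygy : ℕ → A → A → Prop
  | 0, K, M => K = M
  | n + 1, K, M => ∃ L : A, IsSyzygyStep L M ∧ IsSyzygy n K L

theorem exists_isSyzygy [EnoughProjectives A] (n : ℕ) (M : A) : ∃ K, IsSyzygy n K M := by
  induction n generalizing M with
  | zero => exact ⟨M, rfl⟩
  | succ n ih =>
    obtain ⟨L, P, f, g, hP, hS⟩ := exists_isSES_of_enoughProjectives M
    obtain ⟨K, hK⟩ := ih L
    exact ⟨K, L, ⟨P, f, g, hP, hS⟩, hK⟩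

theorem IsSyzygy.projective {n : ℕ} {K M : A} (h : IsSyzygy n K M)
    (hM : HasProjectiveDimensionLT M (n + 1)) : Projective K := by
  induction n generalizing M with
  | zero =>
    cases h
    exact projective_iff_hasProjectiveDimensionLT_one.mpr hM
  | succ n ih =>
    obtain ⟨L, ⟨P, f, g, hP, hw, hS⟩, hK⟩ := h
    exact ih hK ((hS.hasProjectiveDimensionLT_X₃_iff n hP).mp hM)

theorem IsSyzygy.subsingleton_ext [HasExt.{w} A] {n : ℕ} {K M : A} (h : IsSyzygy n K M) (N : A)
    [Subsingleton (Ext K N 1)] : Subsingleton (Ext M N (n + 1)) := by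
  induction n generalizing M with
  | zero =>
    cases h
    assumption
  | succ n ih =>
    obtain ⟨L, ⟨P, f, g, hP, hS⟩, hK⟩ := h
    have := ih hK
    exact hS.subsingleton_ext_right hP N n

section Horseshoe

variable {R : Type u} [Ring R]

/-- The horseshoe lemma, with a prescribed presentation of the submodule. -/
theorem IsSyzygyStep.exists_isSES {X₀ X Y Z : ModuleCat.{u} R} (hX : IsSyzygyStep X₀ X)
    {f : X ⟶ Y} {g : Y ⟶ Z} (h : IsSES f g) :
    ∃ (Y₀ Z₀ : ModuleCat.{u} R) (f₀ : X₀ ⟶ Y₀) (g₀ : Y₀ ⟶ Z₀),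
      IsSyzygyStep Y₀ Y ∧ IsSyzygyStep Z₀ Z ∧ IsSES f₀ g₀ := by
  obtain ⟨P, i, p, hP, hX⟩ := hX
  obtain ⟨W, Q, j, q, hQ, hZ⟩ := exists_isSES_of_enoughProjectives Z
  obtain ⟨hf, hfg, hg⟩ := isSES_iff.mp h
  obtain ⟨hi, hip, hp⟩ := isSES_iff.mp hX
  obtain ⟨-, -, hq⟩ := isSES_iff.mp hZ
  have : Module.Projective R Q := inferInstance
  obtain ⟨s, hs⟩ := Module.projective_lifting_property g.hom q.hom hg
  have hs' (x : Q) : g.hom (s x) = q.hom x := LinearMap.congr_fun hs x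
  let t : (P × Q) →ₗ[R] Y := (f.hom ∘ₗ p.hom).coprod s
  have ht (y : P × Q) : t y = f.hom (p.hom y.1) + s y.2 := rfl
  have hgt (y : P × Q) : g.hom (t y) = q.hom y.2 := by
    rw [ht, map_add, hfg.apply_apply_eq_zero, zero_add, hs']
  have htsurj : Function.Surjective t := by
    intro y
    obtain ⟨x, hx⟩ := hq (g.hom y)
    obtain ⟨z, hz⟩ := (hfg (y - s x)).mp (by rw [map_sub, hs', hx, sub_self])
    obtain ⟨w, rfl⟩ := hp z
    exact ⟨(w, x), by rw [ht, hz, sub_add_cancel]⟩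
  let f₀ : X₀ →ₗ[R] LinearMap.ker t := (LinearMap.inl R P Q ∘ₗ i.hom).codRestrict _ fun x => by
    simp [ht, hip.apply_apply_eq_zero]
  let g₀ : LinearMap.ker t →ₗ[R] LinearMap.ker q.hom :=
    (LinearMap.snd R P Q ∘ₗ (LinearMap.ker t).subtype).codRestrict _ fun y => by
      have hy := hgt y
      rw [LinearMap.mem_ker.mp y.2, map_zero] at hy
      exact hy.symm
  refine ⟨ModuleCat.of R (LinearMap.ker t), ModuleCat.of R (LinearMap.ker q.hom),
    ModuleCat.ofHom f₀, ModuleCat.ofHom g₀,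
    ⟨ModuleCat.of R (P × Q), _, _, inferInstance,
      isSES_ofHom Subtype.val_injective (LinearMap.exact_subtype_ker_map t) htsurj⟩,
    ⟨Q, _, _, hQ,
      isSES_ofHom Subtype.val_injective (LinearMap.exact_subtype_ker_map q.hom) hq⟩,
    isSES_ofHom (fun x y hxy => hi (congrArg (fun z => z.1.1) hxy)) (fun y => ⟨fun hy => ?_, ?_⟩)
      fun x => ?_⟩
  · have hy2 : y.1.2 = 0 := congrArg Subtype.val hy
    have hy1 := LinearMap.mem_ker.mp y.2
    rw [ht, hy2, map_zero, add_zero] at hy1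
    obtain ⟨x, hx⟩ := (hip y.1.1).mp (hf (hy1.trans (map_zero f.hom).symm))
    exact ⟨x, Subtype.ext (Prod.ext hx hy2.symm)⟩
  · rintro ⟨x, rfl⟩
    rfl
  · obtain ⟨z, hz⟩ := (hfg (s x)).mp ((hs' x).trans x.2)
    obtain ⟨w, rfl⟩ := hp z
    exact ⟨⟨(-w, x), by rw [LinearMap.mem_ker, ht, map_neg, map_neg, hz, neg_add_cancel]⟩, rfl⟩

theorem IsSyzygy.exists_isSES {n : ℕ} {X₀ X Y Z : ModuleCat.{u} R} (hX : IsSyzygy n X₀ X)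
    {f : X ⟶ Y} {g : Y ⟶ Z} (h : IsSES f g) :
    ∃ (Y₀ Z₀ : ModuleCat.{u} R) (f₀ : X₀ ⟶ Y₀) (g₀ : Y₀ ⟶ Z₀),
      IsSyzygy n Y₀ Y ∧ IsSyzygy n Z₀ Z ∧ IsSES f₀ g₀ := by
  induction n generalizing X Y Z with
  | zero =>
    cases hX
    exact ⟨Y, Z, f, g, rfl, rfl, h⟩
  | succ n ih =>
    obtain ⟨L, hL, hX⟩ := hX
    obtain ⟨Y₁, Z₁, f₁, g₁, hY₁, hZ₁, h₁⟩ := hL.exists_isSES h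
    obtain ⟨Y₀, Z₀, f₀, g₀, hY₀, hZ₀, h₀⟩ := ih hX h₁
    exact ⟨Y₀, Z₀, f₀, g₀, ⟨Y₁, hY₁, hY₀⟩, ⟨Z₁, hZ₁, hZ₀⟩, h₀⟩

theorem IsSyzygy.isGorensteinProjective {n : ℕ}
    (hproj : ∀ P : ModuleCat.{u} R, Projective P → HasInjectiveDimensionLT P (n + 1))
    (hinj : ∀ I : ModuleCat.{u} R, Injective I → HasProjectiveDimensionLT I (n + 1))
    {K M : ModuleCat.{u} R} (h : IsSyzygy n K M) : IsGorensteinProjective K := by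
  obtain ⟨Z, rfl, hZ⟩ := exists_int_chain (α := ModuleCat.{u} R) IsSyzygyStep
    (fun K => ∃ M, IsSyzygy n K M)
    (fun K ⟨M, hM⟩ => by
      obtain ⟨I, C, f, g, hI, hS⟩ := exists_isSES_of_enoughInjectives M
      obtain ⟨P, C₀, f₀, g₀, hP, hC₀, h₀⟩ := hM.exists_isSES hS
      exact ⟨C₀, ⟨C, hC₀⟩, P, f₀, g₀, hP.projective (hinj I hI), h₀⟩)
    (fun M => by
      obtain ⟨K, P, f, g, hP, hS⟩ := exists_isSES_of_enoughProjectives M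
      exact ⟨K, P, f, g, hP, hS⟩)
    ⟨M, h⟩
  have hZ' (k : ℤ) : IsSyzygyStep (Z (k - 1)) (Z (k + 1 - 1)) := by
    have := hZ (k - 1)
    rwa [sub_add_eq_add_sub] at this
  exact isGorensteinProjective_of_syzygy_chain (Z := fun k => Z (k - 1)) hZ' fun k Q hQ =>
    subsingleton_ext_one_of_syzygy_chain (Z := fun k => Z (k - 1)) hZ' (hproj Q hQ) k

end Horseshoe

/-- over an `n`-Gorenstein ring `R` (left and right Noetherian, with the
injective dimensions of `R` as a left and as a right module over itself at most `n`),
for a left `R`-module `M` the following are equivalent: `Ext^1_R(G, M) = 0` for every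
Gorenstein projective `G`; `M` has projective dimension `≤ n`; `M` has finite projective
dimension; `M` has injective dimension `≤ n`; `M` has finite injective dimension. -/
theorem stmt_2 (R : Type u) [Ring R] [IsNoetherianRing R] [IsNoetherianRing Rᵐᵒᵖ]
    [HasExt.{w} (ModuleCat.{u} R)] (n : ℕ)
    (hGorLeft : CodimLE (fun I : ModuleCat.{u} R => Injective I) n (ModuleCat.of R R))
    (hGorRight :
      CodimLE (fun I : ModuleCat.{u} Rᵐᵒᵖ => Injective I) n (ModuleCat.of Rᵐᵒᵖ Rᵐᵒᵖ))
    (M : ModuleCat.{u} R) :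
    ((∀ G : ModuleCat.{u} R, IsGorensteinProjective G →
        Subsingleton (Abelian.Ext G M 1)) ↔
      DimLE (fun P : ModuleCat.{u} R => Projective P) n M) ∧
    (DimLE (fun P : ModuleCat.{u} R => Projective P) n M ↔
      ∃ m : ℕ, DimLE (fun P : ModuleCat.{u} R => Projective P) m M) ∧
    ((∃ m : ℕ, DimLE (fun P : ModuleCat.{u} R => Projective P) m M) ↔
      CodimLE (fun I : ModuleCat.{u} R => Injective I) n M) ∧
    (CodimLE (fun I : ModuleCat.{u} R => Injective I) n M ↔
      ∃ m : ℕ, CodimLE (fun I : ModuleCat.{u} R => Injective I) m M) := by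
  rw [codimLE_injective_iff] at hGorLeft hGorRight
  simp only [dimLE_projective_iff, codimLE_injective_iff]
  have hproj := hasInjectiveDimensionLT_of_projective hGorLeft
  have hinj := hasProjectiveDimensionLT_of_injective hGorLeft hGorRight
  have hpi (m : ℕ) : HasProjectiveDimensionLT M (m + 1) → HasInjectiveDimensionLT M (n + 1) :=
    hasInjectiveDimensionLT_of_hasProjectiveDimensionLT hproj m
  have hip (m : ℕ) : HasInjectiveDimensionLT M (m + 1) → HasProjectiveDimensionLT M (n + 1) :=
    hasProjectiveDimensionLT_of_hasInjectiveDimensionLT hinj m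
  refine ⟨⟨fun h => ?_, fun h G hG => hG.subsingleton_ext_one (hpi n h)⟩,
    ⟨fun h => ⟨n, h⟩, fun ⟨m, h⟩ => hip n (hpi m h)⟩,
    ⟨fun ⟨m, h⟩ => hpi m h, fun h => ⟨n, hip n h⟩⟩,
    ⟨fun h => ⟨n, h⟩, fun ⟨m, h⟩ => hpi n (hip m h)⟩⟩
  refine hip n (hasInjectiveDimensionLT_of_enoughProjectives M (n + 1) fun X => ?_)
  obtain ⟨K, hK⟩ := exists_isSyzygy n X
  have := h K (hK.isGorensteinProjective hproj hinj)
  exact hK.subsingleton_ext M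
end

section
/- Assume moreover that 𝒞 is closed under direct summands. Then for any non-negative integer n, an object M of 𝒜 lies in both 𝒢(𝒞)^{≤n} and 𝒢(𝒞)^{⊥1} if and only if M lies in 𝒞^{≤n}; that is, 𝒢(𝒞)^{≤n} ∩ 𝒢(𝒞)^{⊥1} = 𝒞^{≤n}. -/
open CategoryTheory CategoryTheory.Limits CategoryTheory.Abelian ZeroObject

universe w t v u

variable {A : Type u} [Category.{v} A] [Abelian A]

namespace IsSES

variable {X Y Z : A} {f : X ⟶ Y} {g : Y ⟶ Z}

lemma zero (h : IsSES f g) : f ≫ g = 0 := h.choose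

lemma shortExact (h : IsSES f g) : (ShortComplex.mk f g h.zero).ShortExact := h.choose_spec

lemma mono_s6 (h : IsSES f g) : Mono f := h.shortExact.mono_f

lemma epi_s6 (h : IsSES f g) : Epi g := h.shortExact.epi_g

lemma exists_desc (h : IsSES f g) {T : A} (k : Y ⟶ T) (hk : f ≫ k = 0) :
    ∃ k' : Z ⟶ T, g ≫ k' = k :=
  have := h.epi_s6
  ⟨h.shortExact.exact.desc k hk, h.shortExact.exact.g_desc k hk⟩

lemma exists_lift (h : IsSES f g) {T : A} (k : T ⟶ Y) (hk : k ≫ g = 0) :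
    ∃ k' : T ⟶ X, k' ≫ f = k :=
  have := h.mono_s6
  ⟨h.shortExact.exact.lift k hk, h.shortExact.exact.lift_f k hk⟩

lemma of_desc [Mono f] [Epi g] (hw : f ≫ g = 0)
    (h : ∀ ⦃T : A⦄ (k : Y ⟶ T), f ≫ k = 0 → ∃ k' : Z ⟶ T, g ≫ k' = k) : IsSES f g :=
  ⟨hw, { exact := ShortComplex.exact_of_g_is_cokernel _
          (CokernelCofork.IsColimit.ofπ' g hw fun k hk =>
            ⟨(h k hk).choose, (h k hk).choose_spec⟩)
         mono_f := ‹_›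
         epi_g := ‹_› }⟩

lemma of_lift [Mono f] [Epi g] (hw : f ≫ g = 0)
    (h : ∀ ⦃T : A⦄ (k : T ⟶ Y), k ≫ g = 0 → ∃ k' : T ⟶ X, k' ≫ f = k) : IsSES f g :=
  ⟨hw, { exact := ShortComplex.exact_of_f_is_kernel _
          (KernelFork.IsLimit.ofι' f hw fun k hk =>
            ⟨(h k hk).choose, (h k hk).choose_spec⟩)
         mono_f := ‹_›
         epi_g := ‹_› }⟩

lemma iso_comp (h : IsSES f g) {X' : A} (e : X' ≅ X) : IsSES (e.hom ≫ f) g := by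
  have := h.mono_s6
  have := h.epi_s6
  refine of_desc (by rw [Category.assoc, h.zero, comp_zero]) fun T k hk => h.exists_desc k ?_
  rw [← cancel_epi e.hom, ← Category.assoc, hk, comp_zero]

lemma comp_iso (h : IsSES f g) {Z' : A} (e : Z ≅ Z') : IsSES f (g ≫ e.hom) := by
  have := h.mono_s6
  have := h.epi_s6
  refine of_lift (by rw [← Category.assoc, h.zero, zero_comp]) fun T k hk => h.exists_lift k ?_
  rw [← cancel_mono e.hom, Category.assoc, hk, zero_comp]

lemma mid_iso (h : IsSES f g) {Y' : A} (e : Y ≅ Y') : IsSES (f ≫ e.hom) (e.inv ≫ g) := by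
  have := h.mono_s6
  have := h.epi_s6
  refine of_desc (by simp [h.zero]) fun T k hk => ?_
  obtain ⟨k', hk'⟩ := h.exists_desc (e.hom ≫ k) (by simpa using hk)
  exact ⟨k', by simp [hk']⟩

/-- Pushing out a short exact sequence along a morphism out of its first term. -/
lemma pushout (h : IsSES f g) {X' : A} (a : X ⟶ X') :
    IsSES (pushout.inr f a) (pushout.desc g 0 (by simp [h.zero])) := by
  have := h.mono_s6
  have := h.epi_s6
  have : Epi (pushout.desc g 0 (by simp [h.zero]) : Limits.pushout f a ⟶ Z) :=
    epi_of_epi_fac (pushout.inl_desc _ _ _)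
  refine of_desc (pushout.inr_desc _ _ _) fun T k hk => ?_
  obtain ⟨k', hk'⟩ := h.exists_desc (pushout.inl f a ≫ k)
    (by rw [pushout.condition_assoc, hk, comp_zero])
  exact ⟨k', by ext <;> simp [pushout.inl_desc_assoc, pushout.inr_desc_assoc, hk', hk]⟩

/-- Pulling back a short exact sequence along a morphism into its last term. -/
lemma pullback (h : IsSES f g) {Z' : A} (c : Z' ⟶ Z) :
    IsSES (pullback.lift f 0 (by simp [h.zero])) (pullback.snd g c) := by
  have := h.mono_s6
  have := h.epi_s6
  have : Mono (pullback.lift f 0 (by simp [h.zero]) : X ⟶ Limits.pullback g c) :=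
    mono_of_mono_fac (pullback.lift_fst _ _ _)
  refine of_lift (pullback.lift_snd _ _ _) fun T k hk => ?_
  obtain ⟨k', hk'⟩ := h.exists_lift (k ≫ pullback.fst g c)
    (by rw [Category.assoc, pullback.condition, reassoc_of% hk, zero_comp])
  exact ⟨k', by ext <;> simp [pullback.lift_fst, pullback.lift_snd, hk', hk]⟩

/-- The cokernel of a composition of monomorphisms is an extension of their cokernels. -/
lemma exists_comp_mono (h : IsSES f g) {Y' Z' : A} {f' : Y ⟶ Y'} {g' : Y' ⟶ Z'}
    (h' : IsSES f' g') :
    ∃ (Q : A) (q : Y' ⟶ Q) (u : Z ⟶ Q) (v : Q ⟶ Z'), IsSES (f ≫ f') q ∧ IsSES u v := by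
  have := h.mono_s6
  have := h.epi_s6
  have := h'.mono_s6
  refine ⟨_, pushout.inl f' g, _, _, of_desc ?_ fun T k hk => ?_, h'.pushout g⟩
  · rw [Category.assoc, pushout.condition, reassoc_of% h.zero, zero_comp]
  · obtain ⟨k', hk'⟩ := h.exists_desc (f' ≫ k) (by simpa using hk)
    exact ⟨pushout.desc k k' hk'.symm, pushout.inl_desc _ _ _⟩

/-- The kernel of a composition of epimorphisms is an extension of their kernels. -/
lemma exists_comp_epi (h : IsSES f g) {X' Z' : A} {f' : X' ⟶ Z} {g' : Z ⟶ Z'}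
    (h' : IsSES f' g') :
    ∃ (K : A) (i : K ⟶ Y) (u : X ⟶ K) (v : K ⟶ X'), IsSES i (g ≫ g') ∧ IsSES u v := by
  have := h.epi_s6
  have := h'.mono_s6
  have := h'.epi_s6
  refine ⟨_, pullback.fst g f', _, _, of_lift ?_ fun T k hk => ?_, h.pullback f'⟩
  · rw [pullback.condition_assoc, h'.zero, comp_zero]
  · obtain ⟨k', hk'⟩ := h'.exists_lift (k ≫ g) (by simpa using hk)
    exact ⟨pullback.lift k k' hk'.symm, pullback.lift_fst _ _ _⟩

lemma biprod_map_left (h : IsSES f g) (C : A) :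
    IsSES (biprod.map (𝟙 C) f) (biprod.snd ≫ g) := by
  have := h.mono_s6
  have := h.epi_s6
  refine of_desc (by simp [h.zero]) fun T k hk => ?_
  obtain ⟨k', hk'⟩ := h.exists_desc (biprod.inr ≫ k)
    (by simpa using biprod.inr ≫= hk)
  exact ⟨k', by ext <;> simp [hk', show biprod.inl ≫ k = 0 by simpa using biprod.inl ≫= hk]⟩

lemma biprod_map_right (h : IsSES f g) (C : A) :
    IsSES (f ≫ biprod.inr) (biprod.map (𝟙 C) g) := by
  have := h.mono_s6
  have := h.epi_s6
  refine of_lift (by simp [reassoc_of% h.zero]) fun T k hk => ?_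
  obtain ⟨k', hk'⟩ := h.exists_lift (k ≫ biprod.snd)
    (by simpa using hk =≫ biprod.snd)
  exact ⟨k', by ext <;> simp [hk', show k ≫ biprod.fst = 0 by simpa using hk =≫ biprod.fst]⟩

lemma nonempty_iso_of_retraction (h : IsSES f g) (r : Y ⟶ X) (hr : f ≫ r = 𝟙 X) :
    Nonempty (Y ≅ X ⊞ Z) :=
  have := h.epi_s6
  ⟨(ShortComplex.Splitting.ofExactOfRetraction _ h.shortExact.exact r hr
    h.epi_s6).isoBinaryBiproduct⟩

variable [HasExt.{w} A]

lemma exists_extend (h : IsSES f g) {C : A} (hC : Subsingleton (Ext Z C 1)) (a : X ⟶ C) :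
    ∃ b : Y ⟶ C, f ≫ b = a := by
  obtain ⟨x, hx⟩ := Ext.contravariant_sequence_exact₁ h.shortExact C (Ext.mk₀ a) rfl
    (Subsingleton.elim _ _)
  obtain ⟨b, rfl⟩ := Ext.addEquiv₀.symm.surjective x
  refine ⟨b, Ext.addEquiv₀.symm.injective ?_⟩
  simpa using hx

lemma nonempty_iso_of_ext (h : IsSES f g) (hX : Subsingleton (Ext Z X 1)) :
    Nonempty (Y ≅ X ⊞ Z) :=
  have ⟨r, hr⟩ := h.exists_extend hX (𝟙 X)
  h.nonempty_iso_of_retraction r hr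

/-- Ext vanishes on the middle term of a short exact sequence, covariantly. -/
lemma subsingleton_ext₂ (h : IsSES f g) {T : A} {n : ℕ} (hX : Subsingleton (Ext T X n))
    (hZ : Subsingleton (Ext T Z n)) : Subsingleton (Ext T Y n) := by
  refine subsingleton_of_forall_eq 0 fun x => ?_
  obtain ⟨y, rfl⟩ := Ext.covariant_sequence_exact₂ T h.shortExact x (Subsingleton.elim _ _)
  rw [Subsingleton.elim y 0, Ext.zero_comp]

lemma subsingleton_ext₃ (h : IsSES f g) {T : A} {n : ℕ} (hY : Subsingleton (Ext T Y n))
    (hX : Subsingleton (Ext T X (n + 1))) : Subsingleton (Ext T Z n) := by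
  refine subsingleton_of_forall_eq 0 fun x => ?_
  obtain ⟨y, rfl⟩ := Ext.covariant_sequence_exact₃ T h.shortExact x rfl (Subsingleton.elim _ _)
  rw [Subsingleton.elim y 0, Ext.zero_comp]

lemma subsingleton_ext_contravariant₂ (h : IsSES f g) {T : A} {n : ℕ}
    (hX : Subsingleton (Ext X T n)) (hZ : Subsingleton (Ext Z T n)) :
    Subsingleton (Ext Y T n) := by
  refine subsingleton_of_forall_eq 0 fun x => ?_
  obtain ⟨y, rfl⟩ := Ext.contravariant_sequence_exact₂ h.shortExact T x (Subsingleton.elim _ _)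
  rw [Subsingleton.elim y 0, Ext.comp_zero]

lemma subsingleton_ext_contravariant₃ (h : IsSES f g) {T : A} {n : ℕ}
    (hY : Subsingleton (Ext Y T (n + 1))) (hX : Subsingleton (Ext X T n)) :
    Subsingleton (Ext Z T (n + 1)) := by
  refine subsingleton_of_forall_eq 0 fun x => ?_
  obtain ⟨y, rfl⟩ := Ext.contravariant_sequence_exact₃ h.shortExact T x
    (Subsingleton.elim _ _) (add_comm 1 n)
  rw [Subsingleton.elim y 0, Ext.comp_zero]

lemma subsingleton_ext_one_of_projective (h : IsSES f g) [Projective Y] {T : A}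
    (hT : ∀ a : X ⟶ T, ∃ b : Y ⟶ T, f ≫ b = a) : Subsingleton (Ext Z T 1) := by
  refine subsingleton_of_forall_eq 0 fun x => ?_
  obtain ⟨y, rfl⟩ := Ext.contravariant_sequence_exact₃ h.shortExact T x
    (Ext.eq_zero_of_projective _) (add_zero 1)
  obtain ⟨a, rfl⟩ := Ext.addEquiv₀.symm.surjective y
  obtain ⟨b, rfl⟩ := hT a
  have : Ext.addEquiv₀.symm (f ≫ b) = (Ext.mk₀ f).comp (Ext.mk₀ b) (zero_add 0) := by simp
  rw [this]
  exact h.shortExact.extClass_comp_assoc (Ext.mk₀ b)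

lemma horseshoe_mono (h : IsSES f g) {C₁ C₂ X' Z' : A} {i₁ : X ⟶ C₁} {p₁ : C₁ ⟶ X'}
    {i₂ : Z ⟶ C₂} {p₂ : C₂ ⟶ Z'} (h₁ : IsSES i₁ p₁) (h₂ : IsSES i₂ p₂)
    (hZ : Subsingleton (Ext Z C₁ 1)) :
    ∃ (Q : A) (i : Y ⟶ C₁ ⊞ C₂) (p : C₁ ⊞ C₂ ⟶ Q) (u : X' ⟶ Q) (v : Q ⟶ Z'),
      IsSES i p ∧ IsSES u v := by
  obtain ⟨e⟩ := (h.pushout i₁).nonempty_iso_of_ext hZ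
  have hbc := (h₁.pushout f).mid_iso (pushoutSymmetry i₁ f)
  obtain ⟨Q, q, u, v, hq, huv⟩ := (hbc.mid_iso e).exists_comp_mono (h₂.biprod_map_left C₁)
  exact ⟨Q, _, q, u, v, hq, huv⟩

lemma horseshoe_epi (h : IsSES f g) {C₁ C₂ X' Z' : A} {i₁ : X' ⟶ C₁} {p₁ : C₁ ⟶ X}
    {i₂ : Z' ⟶ C₂} {p₂ : C₂ ⟶ Z} (h₁ : IsSES i₁ p₁) (h₂ : IsSES i₂ p₂)
    (hC₂ : Subsingleton (Ext C₂ X 1)) :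
    ∃ (K : A) (i : K ⟶ C₂ ⊞ C₁) (p : C₂ ⊞ C₁ ⟶ Y) (u : X' ⟶ K) (v : K ⟶ Z'),
      IsSES i p ∧ IsSES u v := by
  obtain ⟨e⟩ := (h.pullback p₂).nonempty_iso_of_ext hC₂
  have hbc := (h₂.pullback g).mid_iso (pullbackSymmetry p₂ g)
  obtain ⟨K, i, u, v, hi, huv⟩ :=
    (h₁.biprod_map_right C₂).exists_comp_epi (hbc.mid_iso (e ≪≫ biprod.braiding _ _))
  exact ⟨K, i, _, u, v, hi, huv⟩

end IsSES

/-- A serial and co-serial relation on a class admits bi-infinite chains through each point. -/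
lemma exists_int_chain_s6 {α : Type*} {p : α → Prop} {r : α → α → Prop}
    (hsucc : ∀ a, p a → ∃ b, p b ∧ r a b) (hpred : ∀ a, p a → ∃ b, p b ∧ r b a)
    {a : α} (ha : p a) (k : ℤ) :
    ∃ w : ℤ → α, w k = a ∧ (∀ n, p (w n)) ∧ ∀ n, r (w n) (w (n + 1)) := by
  choose s hs using fun x : {a // p a} => hsucc x.1 x.2
  choose t ht using fun x : {a // p a} => hpred x.1 x.2
  let S : {a // p a} → {a // p a} := fun x => ⟨s x, (hs x).1⟩
  let T : {a // p a} → {a // p a} := fun x => ⟨t x, (ht x).1⟩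
  let w : ℤ → {a // p a} := fun n => match n with
    | Int.ofNat m => S^[m] ⟨a, ha⟩
    | Int.negSucc m => T^[m + 1] ⟨a, ha⟩
  have hw : ∀ n, r (w n).1 (w (n + 1)).1 := by
    rintro (m | m)
    · change r (S^[m] _).1 (S^[m + 1] _).1
      rw [Function.iterate_succ_apply']
      exact (hs _).2
    · have hT : ∀ m, r (T^[m + 1] ⟨a, ha⟩).1 (T^[m] ⟨a, ha⟩).1 := fun m => by
        rw [Function.iterate_succ_apply']
        exact (ht _).2
      cases m with
      | zero => exact hT 0
      | succ m => exact hT (m + 1)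
  refine ⟨fun n => (w (n - k)).1, ?_, fun n => (w _).2, fun n => ?_⟩
  · simp only [sub_self]
    rfl
  · have h := hw (n - k)
    rwa [← add_sub_right_comm] at h

lemma DimLE.mono_s6 {𝒳 𝒴 : A → Prop} (h : ∀ ⦃X⦄, 𝒳 X → 𝒴 X) {n : ℕ} {M : A}
    (hM : DimLE 𝒳 n M) : DimLE 𝒴 n M := by
  induction n generalizing M with
  | zero =>
    obtain ⟨X, hX, e⟩ := hM
    exact ⟨X, h hX, e⟩
  | succ n ih =>
    obtain ⟨K, X, f, g, hX, hs, hK⟩ := hM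
    exact ⟨K, X, f, g, h hX, hs, ih hK⟩

section

variable {𝒞 : A → Prop}

lemma IsGorenstein.of_iso {M N : A} (e : N ≅ M) (h : IsGorenstein 𝒞 M) : IsGorenstein 𝒞 N := by
  obtain ⟨X, d, hw, hX, hd, hl, hr, ⟨i⟩⟩ := h
  exact ⟨X, d, hw, hX, hd, hl, hr, ⟨e ≪≫ i⟩⟩

/-- The short exact sequence of images at an exact spot. -/
lemma isSES_image {X Y Z : A} {f : X ⟶ Y} {g : Y ⟶ Z} (hw : f ≫ g = 0)
    (h : (ShortComplex.mk f g hw).Exact) :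
    IsSES (Limits.image.ι f) (factorThruImage g) := by
  have hz : Limits.image.ι f ≫ factorThruImage g = 0 := by
    rw [← cancel_epi (factorThruImage f), ← cancel_mono (Limits.image.ι g)]
    simpa using hw
  have hz' : Limits.image.ι f ≫ g = 0 := by
    rw [← cancel_epi (factorThruImage f)]
    simpa using hw
  let φ : ShortComplex.mk f g hw ⟶ ShortComplex.mk (Limits.image.ι f) g hz' :=
    { τ₁ := factorThruImage f, τ₂ := 𝟙 _, τ₃ := 𝟙 _ }
  let ψ : ShortComplex.mk (Limits.image.ι f) (factorThruImage g) hz ⟶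
      ShortComplex.mk (Limits.image.ι f) g hz' :=
    { τ₁ := 𝟙 _, τ₂ := 𝟙 _, τ₃ := Limits.image.ι g }
  have : Epi φ.τ₁ := inferInstanceAs (Epi (factorThruImage f))
  have : IsIso φ.τ₂ := inferInstanceAs (IsIso (𝟙 _))
  have : Mono φ.τ₃ := inferInstanceAs (Mono (𝟙 _))
  have : Epi ψ.τ₁ := inferInstanceAs (Epi (𝟙 _))
  have : IsIso ψ.τ₂ := inferInstanceAs (IsIso (𝟙 _))
  have : Mono ψ.τ₃ := inferInstanceAs (Mono (Limits.image.ι g))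
  exact ⟨hz, { exact := (ShortComplex.exact_iff_of_epi_of_isIso_of_mono ψ).2
                ((ShortComplex.exact_iff_of_epi_of_isIso_of_mono φ).1 h)
               mono_f := inferInstanceAs (Mono (Limits.image.ι f))
               epi_g := inferInstanceAs (Epi (factorThruImage g)) }⟩

variable [HasExt.{w} A]

lemma subsingleton_ext_of_iso {X X' Y : A} (e : X ≅ X') {n : ℕ}
    (h : Subsingleton (Ext X' Y n)) : Subsingleton (Ext X Y n) := by
  refine subsingleton_of_forall_eq 0 fun x => ?_
  have hx : x = (Ext.mk₀ e.hom).comp ((Ext.mk₀ e.inv).comp x (zero_add n)) (zero_add n) := by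
    simp
  rw [hx, Subsingleton.elim ((Ext.mk₀ e.inv).comp x _) 0, Ext.comp_zero]

lemma subsingleton_ext_of_iso_right {X Y Y' : A} (e : Y ≅ Y') {n : ℕ}
    (h : Subsingleton (Ext X Y' n)) : Subsingleton (Ext X Y n) := by
  refine subsingleton_of_forall_eq 0 fun x => ?_
  have hx : x = (x.comp (Ext.mk₀ e.hom) (add_zero n)).comp (Ext.mk₀ e.inv) (add_zero n) := by
    simp
  rw [hx, Subsingleton.elim (x.comp (Ext.mk₀ e.hom) _) 0, Ext.zero_comp]

lemma ProjIsGeneratorFor.projective (hgen : ProjIsGeneratorFor 𝒞) (hso : SelfOrthogonal 𝒞)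
    {C : A} (hC : 𝒞 C) : Projective C := by
  obtain ⟨C', P, f, g, hP, hC', h⟩ := hgen hC
  obtain ⟨e⟩ := h.nonempty_iso_of_ext (hso hC hC' 1 le_rfl)
  exact Retract.projective (Y := P) ⟨biprod.inr ≫ e.inv, e.hom ≫ biprod.snd, by simp⟩

/-- Coinduction principle for the Gorenstein subcategory. -/
lemma IsGorenstein.of_class (hproj : ∀ ⦃C⦄, 𝒞 C → Projective C) (𝒲 : A → Prop)
    (hext : ∀ ⦃W⦄, 𝒲 W → ∀ ⦃C⦄, 𝒞 C → Subsingleton (Ext W C 1))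
    (hright : ∀ W, 𝒲 W → ∃ W', 𝒲 W' ∧ ∃ (X : A) (f : W ⟶ X) (g : X ⟶ W'), 𝒞 X ∧ IsSES f g)
    (hleft : ∀ W, 𝒲 W → ∃ W', 𝒲 W' ∧ ∃ (X : A) (f : W' ⟶ X) (g : X ⟶ W), 𝒞 X ∧ IsSES f g)
    {G : A} (hG : 𝒲 G) : IsGorenstein 𝒞 G := by
  obtain ⟨W, rfl, hW, hr⟩ := exists_int_chain_s6 hright hleft hG (0 + 1)
  choose X f g hX h using hr
  have hmono := fun n => (h n).mono_s6
  have hepi := fun n => (h n).epi_s6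
  have := strongEpi_of_epi (g 0)
  have hw : ∀ n, (g n ≫ f (n + 1)) ≫ g (n + 1) ≫ f (n + 1 + 1) = 0 := fun n => by
    rw [Category.assoc, reassoc_of% (h (n + 1)).zero, zero_comp, comp_zero]
  have hl : ∀ (n : ℤ) {T : A} (k : T ⟶ X (n + 1)), k ≫ g (n + 1) ≫ f (n + 1 + 1) = 0 →
      ∃ l : T ⟶ W (n + 1), l ≫ f (n + 1) = k := fun n T k hk =>
    (h (n + 1)).exists_lift k (by rwa [← cancel_mono (f (n + 1 + 1)), Category.assoc, zero_comp])
  refine ⟨X, fun n => g n ≫ f (n + 1), hw, hX, fun n => ?_, fun n C hC k => ⟨fun hk => ?_, ?_⟩,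
    fun n C hC k => ⟨fun hk => ?_, ?_⟩, ⟨image.isoStrongEpiMono _ (f (0 + 1)) rfl⟩⟩
  · rw [ShortComplex.exact_iff_exact_up_to_refinements]
    intro T k hk
    obtain ⟨l, rfl⟩ := hl n k hk
    exact ⟨_, pullback.snd (g n) l, inferInstance, pullback.fst (g n) l,
      by simp [pullback.condition_assoc]⟩
  · have := hproj hC
    obtain ⟨l, rfl⟩ := hl n k hk
    exact ⟨Projective.factorThru l (g n), by simp⟩
  · rintro ⟨l, rfl⟩
    simpa using l ≫= hw n
  · have hk' : f (n + 1) ≫ k = 0 := by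
      simpa [← cancel_epi (g n)] using hk
    obtain ⟨l, rfl⟩ := (h (n + 1)).exists_desc k hk'
    obtain ⟨m, rfl⟩ := (h (n + 1 + 1)).exists_extend (hext (hW _) hC) l
    exact ⟨m, by simp⟩
  · rintro ⟨l, rfl⟩
    simpa using hw n =≫ l

/-- A Gorenstein object has vanishing first extensions by `𝒞` and is linked by short exact
sequences with middle term in `𝒞` to Gorenstein objects on both sides. -/
lemma IsGorenstein.properties (hproj : ∀ ⦃C⦄, 𝒞 C → Projective C) {G : A}
    (hG : IsGorenstein 𝒞 G) :
    (∀ ⦃C⦄, 𝒞 C → Subsingleton (Ext G C 1)) ∧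
    (∃ G', IsGorenstein 𝒞 G' ∧ ∃ (X : A) (f : G ⟶ X) (g : X ⟶ G'), 𝒞 X ∧ IsSES f g) ∧
    (∃ G', IsGorenstein 𝒞 G' ∧ ∃ (X : A) (f : G' ⟶ X) (g : X ⟶ G), 𝒞 X ∧ IsSES f g) := by
  obtain ⟨X, d, hw, hX, hd, -, hr, ⟨e⟩⟩ := hG
  have hses := fun n => isSES_image (hw n) (hd n)
  have hext : ∀ n ⦃C⦄, 𝒞 C → Subsingleton (Ext (image (d n)) C 1) := fun n C hC => by
    obtain ⟨n, rfl⟩ : ∃ m, n = m + 1 + 1 := ⟨n - 2, by ring⟩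
    have := hproj (hX (n + 1 + 1))
    refine (hses (n + 1)).subsingleton_ext_one_of_projective fun a => ?_
    obtain ⟨b, hb⟩ := (hr n hC (factorThruImage (d (n + 1)) ≫ a)).1 (by
      dsimp only
      have : d n ≫ factorThruImage (d (n + 1)) = 0 := by
        rw [← cancel_mono (Limits.image.ι (d (n + 1)))]
        simpa using hw n
      rw [reassoc_of% this, zero_comp])
    refine ⟨b, ?_⟩
    rw [← cancel_epi (factorThruImage (d (n + 1))), ← hb, Limits.image.fac_assoc]
  have hgor : ∀ n, IsGorenstein 𝒞 (image (d n)) := fun n => by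
    refine IsGorenstein.of_class hproj (fun W => ∃ n, Nonempty (W ≅ image (d n))) ?_ ?_ ?_
      ⟨n, ⟨Iso.refl _⟩⟩
    · rintro W ⟨n, ⟨i⟩⟩ C hC
      exact subsingleton_ext_of_iso i (hext n hC)
    · rintro W ⟨n, ⟨i⟩⟩
      exact ⟨_, ⟨n + 1, ⟨Iso.refl _⟩⟩, X (n + 1), _, _, hX _, (hses n).iso_comp i⟩
    · rintro W ⟨n, ⟨i⟩⟩
      obtain ⟨n, rfl⟩ : ∃ m, n = m + 1 := ⟨n - 1, by ring⟩
      exact ⟨_, ⟨n, ⟨Iso.refl _⟩⟩, X (n + 1), _, _, hX _, (hses n).comp_iso i.symm⟩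
  refine ⟨fun C hC => subsingleton_ext_of_iso e (hext 0 hC), ?_, ?_⟩
  · exact ⟨_, hgor (0 + 1), X (0 + 1), _, _, hX _, (hses 0).iso_comp e⟩
  · obtain ⟨e⟩ : Nonempty (G ≅ image (d (-1 + 1))) := by
      rw [neg_add_cancel]
      exact ⟨e⟩
    exact ⟨_, hgor (-1), X (-1 + 1), _, _, hX _, (hses (-1)).comp_iso e.symm⟩

lemma IsGorenstein.of_mem (hproj : ∀ ⦃C⦄, 𝒞 C → Projective C) (h₀ : 𝒞 (0 : A)) {C : A}
    (hC : 𝒞 C) : IsGorenstein 𝒞 C := by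
  refine IsGorenstein.of_class hproj 𝒞 (fun W hW C _ => ?_) (fun W hW => ?_) (fun W hW => ?_) hC
  · have := hproj hW
    exact subsingleton_of_forall_eq 0 Ext.eq_zero_of_projective
  · exact ⟨0, h₀, W, 𝟙 W, 0, hW, IsSES.of_desc comp_zero fun T k hk =>
      ⟨0, by rw [zero_comp, ← hk, Category.id_comp]⟩⟩
  · exact ⟨0, h₀, W, 0, 𝟙 W, hW, IsSES.of_lift zero_comp fun T k hk =>
      ⟨0, by rw [comp_zero, ← hk, Category.comp_id]⟩⟩

/-- The Gorenstein subcategory is closed under extensions. -/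
lemma IsGorenstein.of_extension (hproj : ∀ ⦃C⦄, 𝒞 C → Projective C)
    (hsum : ∀ ⦃X Y⦄, 𝒞 X → 𝒞 Y → 𝒞 (X ⊞ Y)) {X Y Z : A} {f : X ⟶ Y} {g : Y ⟶ Z}
    (h : IsSES f g) (hX : IsGorenstein 𝒞 X) (hZ : IsGorenstein 𝒞 Z) : IsGorenstein 𝒞 Y := by
  refine IsGorenstein.of_class hproj
    (fun W => ∃ (U V : A) (i : U ⟶ W) (p : W ⟶ V),
      IsSES i p ∧ IsGorenstein 𝒞 U ∧ IsGorenstein 𝒞 V) ?_ ?_ ?_ ⟨X, Z, f, g, h, hX, hZ⟩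
  · rintro W ⟨U, V, i, p, h, hU, hV⟩ C hC
    exact h.subsingleton_ext_contravariant₂ ((hU.properties hproj).1 hC)
      ((hV.properties hproj).1 hC)
  · rintro W ⟨U, V, i, p, h, hU, hV⟩
    obtain ⟨-, ⟨U', hU', C₁, i₁, p₁, hC₁, h₁⟩, -⟩ := hU.properties hproj
    obtain ⟨hext, ⟨V', hV', C₂, i₂, p₂, hC₂, h₂⟩, -⟩ := hV.properties hproj
    obtain ⟨Q, j, q, u, v, hQ, huv⟩ := h.horseshoe_mono h₁ h₂ (hext hC₁)
    exact ⟨Q, ⟨U', V', u, v, huv, hU', hV'⟩, _, j, q, hsum hC₁ hC₂, hQ⟩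
  · rintro W ⟨U, V, i, p, h, hU, hV⟩
    obtain ⟨-, -, U', hU', C₁, i₁, p₁, hC₁, h₁⟩ := hU.properties hproj
    obtain ⟨-, -, V', hV', C₂, i₂, p₂, hC₂, h₂⟩ := hV.properties hproj
    have := hproj hC₂
    obtain ⟨K, j, q, u, v, hK, huv⟩ := h.horseshoe_epi h₁ h₂
      (subsingleton_of_forall_eq 0 Ext.eq_zero_of_projective)
    exact ⟨K, ⟨U', V', u, v, huv, hU', hV'⟩, _, j, q, hsum hC₂ hC₁, hK⟩

lemma IsGorenstein.subsingleton_ext (hproj : ∀ ⦃C⦄, 𝒞 C → Projective C) {C : A} (hC : 𝒞 C)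
    (n : ℕ) {G : A} (hG : IsGorenstein 𝒞 G) : Subsingleton (Ext G C (n + 1)) := by
  induction n generalizing G with
  | zero => exact (hG.properties hproj).1 hC
  | succ n ih =>
    obtain ⟨-, -, G', hG', X, f, g, hX, h⟩ := hG.properties hproj
    have := hproj hX
    exact h.subsingleton_ext_contravariant₃
      (subsingleton_of_forall_eq 0 Ext.eq_zero_of_projective) (ih hG')

lemma DimLE.subsingleton_ext (hproj : ∀ ⦃C⦄, 𝒞 C → Projective C) {m : ℕ} {T : A}
    (hT : DimLE 𝒞 m T) {G : A} (hG : IsGorenstein 𝒞 G) (n : ℕ) :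
    Subsingleton (Ext G T (n + 1)) := by
  induction m generalizing T n with
  | zero =>
    obtain ⟨X, hX, ⟨e⟩⟩ := hT
    exact subsingleton_ext_of_iso_right e (hG.subsingleton_ext hproj hX n)
  | succ m ih =>
    obtain ⟨K, X, f, g, hX, h, hK⟩ := hT
    exact h.subsingleton_ext₃ (hG.subsingleton_ext hproj hX n) (ih hK (n + 1))

/-- An object of finite Gorenstein dimension embeds into an object of the same `𝒞`-dimension with
Gorenstein cokernel. -/
lemma DimLE.exists_isSES (hproj : ∀ ⦃C⦄, 𝒞 C → Projective C)
    (hsum : ∀ ⦃X Y⦄, 𝒞 X → 𝒞 Y → 𝒞 (X ⊞ Y)) {n : ℕ} {M : A}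
    (hM : DimLE (IsGorenstein 𝒞) n M) :
    ∃ (T G : A) (f : M ⟶ T) (g : T ⟶ G), DimLE 𝒞 n T ∧ IsGorenstein 𝒞 G ∧ IsSES f g := by
  induction n generalizing M with
  | zero =>
    obtain ⟨G, hG, ⟨e⟩⟩ := hM
    obtain ⟨-, ⟨G', hG', X, f, g, hX, h⟩, -⟩ := (hG.of_iso e).properties hproj
    exact ⟨X, G', f, g, ⟨X, hX, ⟨Iso.refl X⟩⟩, hG', h⟩
  | succ n ih =>
    obtain ⟨K, G₀, f, g, hG₀, h, hK⟩ := hM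
    obtain ⟨T, G, i, p, hT, hG, hi⟩ := ih hK
    have hE := IsGorenstein.of_extension hproj hsum (hi.pushout f) hG₀ hG
    obtain ⟨-, ⟨G', hG', X, j, q, hX, hj⟩, -⟩ := hE.properties hproj
    obtain ⟨Q, r, u, v, hr, huv⟩ :=
      ((h.pushout i).mid_iso (pushoutSymmetry f i)).exists_comp_mono hj
    exact ⟨Q, G', u, v, ⟨T, X, _, r, hX, hr, hT⟩, hG', huv⟩

/-- A Gorenstein object in `𝒢(𝒞)^{⊥1}` lies in `𝒞`. -/
lemma IsGorenstein.mem_of_rightPerp1 (hproj : ∀ ⦃C⦄, 𝒞 C → Projective C)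
    (hiso : ∀ ⦃X Y : A⦄, (X ≅ Y) → 𝒞 X → 𝒞 Y) (hsummand : ∀ ⦃X Y : A⦄, 𝒞 (X ⊞ Y) → 𝒞 X)
    {G : A} (hG : IsGorenstein 𝒞 G) (hperp : RightPerp1 𝒞 G) : 𝒞 G := by
  obtain ⟨-, ⟨G', hG', X, f, g, hX, h⟩, -⟩ := hG.properties hproj
  obtain ⟨e⟩ := h.nonempty_iso_of_ext (hperp hG')
  exact hsummand (hiso e hX)

end

/-- if moreover `𝒞` is closed under direct summands, then
`𝒢(𝒞)^{≤n} ∩ 𝒢(𝒞)^{⊥1} = 𝒞^{≤n}` for every `n ≥ 0`. -/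
theorem stmt_6 [HasExt.{w} A] (𝒞 : A → Prop) (hadd : IsAdditiveClosed 𝒞)
    (hso : SelfOrthogonal 𝒞) (hgen : ProjIsGeneratorFor 𝒞)
    (hsummand : ∀ ⦃X Y : A⦄, 𝒞 (X ⊞ Y) → 𝒞 X)
    (n : ℕ) (M : A) :
    (DimLE (IsGorenstein 𝒞) n M ∧ RightPerp1 𝒞 M) ↔ DimLE 𝒞 n M := by
  have hproj : ∀ ⦃C⦄, 𝒞 C → Projective C := fun C hC => hgen.projective hso hC
  obtain ⟨hiso, h₀, hsum⟩ := hadd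
  refine ⟨fun ⟨hM, hperp⟩ => ?_, fun hM =>
    ⟨hM.mono_s6 fun C hC => IsGorenstein.of_mem hproj h₀ hC,
      fun G hG => hM.subsingleton_ext hproj hG 0⟩⟩
  cases n with
  | zero =>
    obtain ⟨G, hG, ⟨e⟩⟩ := hM
    exact ⟨M, (hG.of_iso e).mem_of_rightPerp1 hproj hiso hsummand hperp, ⟨Iso.refl M⟩⟩
  | succ n =>
    obtain ⟨K, G₀, f, g, hG₀, h, hK⟩ := hM
    obtain ⟨T, G, i, p, hT, hG, hi⟩ := hK.exists_isSES hproj hsum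
    have hE := IsGorenstein.of_extension hproj hsum (hi.pushout f) hG₀ hG
    have hTE := (h.pushout i).mid_iso (pushoutSymmetry f i)
    exact ⟨T, _, _, _, hE.mem_of_rightPerp1 hproj hiso hsummand fun G' hG' =>
      hTE.subsingleton_ext₂ (hT.subsingleton_ext hproj hG' 0) (hperp hG'), hTE, hT⟩
end
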